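/- arXiv:1207.5314 — 3 statements merged into one kernel-verified Lean document; each statement's English description precedes it below -/
import Mathlib

section
/- For all dominant elements λ, μ ∈ X₊: λ ⪯ μ if and only if λ ⊗ 1 ∈ Conv(Wμ), i.e. a dominant λ lies in the convex hull of the Weyl orbit of a dominant μ exactly when μ − λ is a nonnegative real combination of simple roots. -/
open scoped TensorProduct

/-- A root datum `(X, R, X^∨, R^∨)` together with a fixed system of positive roots
`R₊` and corresponding simple roots `Δ`.  The pairing `pair` is the perfect pairing
`⟨-,-⟩ : X × X^∨ → ℤ`, and `coroot` realizes the bijection `R → R^∨`, `α ↦ α^∨`. -/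
structure RootDatumBase (X Xv : Type) [AddCommGroup X] [AddCommGroup Xv] where
  /-- the perfect pairing `⟨-,-⟩ : X × X^∨ → ℤ` -/
  pair : X →ₗ[ℤ] Xv →ₗ[ℤ] ℤ
  perfect_left : Function.Bijective pair
  perfect_right : Function.Bijective pair.flip
  /-- the (finite) set of roots `R ⊆ X` -/
  R : Finset X
  /-- the set of coroots `R^∨ ⊆ X^∨` -/
  Rv : Finset Xv
  /-- the coroot map `α ↦ α^∨` -/
  coroot : X → Xv
  coroot_bijOn : Set.BijOn coroot ↑R ↑Rv
  pair_self : ∀ α ∈ R, pair α (coroot α) = 2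
  /-- the reflections `s_α (x) = x - ⟨x, α^∨⟩ α` preserve `R` -/
  reflect_mem : ∀ α ∈ R, ∀ β ∈ R, β - pair β (coroot α) • α ∈ R
  /-- the dual reflections preserve `R^∨` -/
  coreflect_mem : ∀ α ∈ R, ∀ γ ∈ Rv, γ - pair α γ • coroot α ∈ Rv
  /-- the root system is reduced -/
  reduced : ∀ α ∈ R, ∀ n : ℤ, n • α ∈ R → n = 1 ∨ n = -1
  /-- the system of positive roots `R₊` -/
  Rpos : Finset X
  Rpos_subset : Rpos ⊆ R
  pos_or_neg : ∀ α ∈ R, α ∈ Rpos ∨ -α ∈ Rpos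
  not_pos_and_neg : ∀ α ∈ Rpos, -α ∉ Rpos
  /-- the set of simple roots `Δ ⊆ R₊` -/
  Δ : Finset X
  Δ_subset : Δ ⊆ Rpos
  /-- every positive root is an `ℕ`-linear combination of simple roots -/
  pos_eq_nat_comb : ∀ α ∈ Rpos, ∃ c : X → ℕ, α = ∑ β ∈ Δ, c β • β
  /-- `⟨α, β^∨⟩ ≤ 0` for distinct simple roots `α, β` -/
  simple_obtuse : ∀ α ∈ Δ, ∀ β ∈ Δ, α ≠ β → pair α (coroot β) ≤ 0
  /-- the simple roots are linearly independent -/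
  simple_indep : LinearIndependent ℤ (fun a : {x // x ∈ Δ} => (a : X))

namespace RootDatumBase

variable {X Xv : Type} [AddCommGroup X] [AddCommGroup Xv] (D : RootDatumBase X Xv)

/-- the cone of dominant elements `X₊ = {μ ∈ X | ⟨μ, α^∨⟩ ≥ 0 ∀ α ∈ R₊}` -/
def Xplus : Set X := {μ : X | ∀ α ∈ D.Rpos, 0 ≤ D.pair μ (D.coroot α)}

/-- `Q₊`, the submonoid of `X` generated by the positive roots -/
def Qplus : AddSubmonoid X := AddSubmonoid.closure ↑D.Rpos

/-- `Q`, the subgroup of `X` generated by the roots -/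
def Qgrp : AddSubgroup X := AddSubgroup.closure ↑D.R

/-- the dominance order: `λ ≤ μ` iff `μ - λ ∈ Q₊` -/
def dle (l m : X) : Prop := m - l ∈ D.Qplus

/-- the canonical map `X → X ⊗ ℝ`, `x ↦ x ⊗ 1` -/
noncomputable def toReal (X : Type) [AddCommGroup X] : X →ₗ[ℤ] ℝ ⊗[ℤ] X :=
  TensorProduct.mk ℤ ℝ X 1

/-- the weak order: `λ ⪯ μ` iff `(μ - λ) ⊗ 1` is a nonnegative real combination of
the simple roots in `X ⊗ ℝ` -/
noncomputable def dpreceq (l m : X) : Prop :=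
  ∃ c : X → ℝ, (∀ β : X, 0 ≤ c β) ∧
    toReal X (m - l) = ∑ β ∈ D.Δ, c β • toReal X β

/-- the Weyl group `W ≤ Aut(X)`, generated by the reflections `s_α`, `α ∈ R` -/
def Weyl : Subgroup (X ≃ₗ[ℤ] X) :=
  Subgroup.closure {w : X ≃ₗ[ℤ] X | ∃ α ∈ D.R, ∀ x : X, w x = x - D.pair x (D.coroot α) • α}

/-- the Weyl group orbit `W ν` of `ν ∈ X` -/
def WOrbit (ν : X) : Set X := {x : X | ∃ w ∈ D.Weyl, x = w ν}

/-- `Conv(Wν)`, the convex hull in `X ⊗ ℝ` of the Weyl orbit of `ν ⊗ 1` -/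
noncomputable def ConvW (ν : X) : Set (ℝ ⊗[ℤ] X) :=
  convexHull ℝ (toReal X '' D.WOrbit ν)

end RootDatumBase

namespace RootDatumBase

section helpers

variable {X Xv : Type} [AddCommGroup X] [AddCommGroup Xv] (D : RootDatumBase X Xv)

/-- the reflection as a linear map -/
def refl (α : X) : X →ₗ[ℤ] X :=
  LinearMap.id - (D.pair.flip (D.coroot α)).smulRight α

lemma refl_apply (α x : X) : D.refl α x = x - D.pair x (D.coroot α) • α := by
  simp [refl]

lemma refl_self {α : X} (h : α ∈ D.R) : D.refl α α = -α := by
  rw [refl_apply, D.pair_self α h]; module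

lemma refl_refl {α : X} (h : α ∈ D.R) (x : X) : D.refl α (D.refl α x) = x := by
  simp only [refl_apply, map_sub, map_smul, LinearMap.sub_apply, LinearMap.smul_apply,
    D.pair_self α h, smul_eq_mul]
  module

lemma pair_refl {α : X} (h : α ∈ D.R) (x : X) :
    D.pair (D.refl α x) (D.coroot α) = - D.pair x (D.coroot α) := by
  simp only [refl_apply, map_sub, map_smul, LinearMap.sub_apply, LinearMap.smul_apply,
    D.pair_self α h, smul_eq_mul]
  ring

lemma refl_mem {α β : X} (h : α ∈ D.R) (hb : β ∈ D.R) : D.refl α β ∈ D.R := by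
  rw [refl_apply]; exact D.reflect_mem α h β hb

lemma delta_R {α : X} (h : α ∈ D.Δ) : α ∈ D.R := D.Rpos_subset (D.Δ_subset h)

/-- the canonical invariant form -/
def form (x y : X) : ℤ := ∑ g ∈ D.Rv, D.pair x g * D.pair y g

lemma form_refl {α : X} (h : α ∈ D.R) (x y : X) :
    D.form (D.refl α x) (D.refl α y) = D.form x y := by
  have key : ∀ x g, D.pair (D.refl α x) g = D.pair x (g - D.pair α g • D.coroot α) := by
    intro x g
    simp only [refl_apply, map_sub, map_smul, LinearMap.sub_apply, LinearMap.smul_apply,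
      smul_eq_mul]
    ring
  have inv : ∀ g, (g - D.pair α g • D.coroot α)
      - D.pair α (g - D.pair α g • D.coroot α) • D.coroot α = g := by
    intro g
    simp only [map_sub, map_smul, D.pair_self α h, smul_eq_mul]
    module
  unfold form
  refine Finset.sum_nbij' (fun g => g - D.pair α g • D.coroot α)
    (fun g => g - D.pair α g • D.coroot α) ?_ ?_ ?_ ?_ ?_
  · intro g hg; exact D.coreflect_mem α h g hg
  · intro g hg; exact D.coreflect_mem α h g hg
  · intro g _; exact inv g
  · intro g _; exact inv g
  · intro g _; rw [key, key]

lemma form_pos {α : X} (h : α ∈ D.R) : 0 < D.form α α := by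
  unfold form
  refine Finset.sum_pos' (fun g _ => mul_self_nonneg _) ⟨D.coroot α, ?_, ?_⟩
  · exact D.coroot_bijOn.mapsTo h
  · rw [D.pair_self α h]; norm_num

lemma form_sub_smul_neg (x α : X) (n : ℤ) :
    D.form (x - n • α) (-α) = - D.form x α + n * D.form α α := by
  unfold form
  rw [Finset.mul_sum, ← Finset.sum_neg_distrib, ← Finset.sum_add_distrib]
  refine Finset.sum_congr rfl fun g _ => ?_
  simp only [map_sub, map_smul, map_neg, LinearMap.sub_apply, LinearMap.smul_apply,
    LinearMap.neg_apply, smul_eq_mul]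
  ring

lemma form_neg (x α : X) : D.form x (-α) = - D.form x α := by
  unfold form
  rw [← Finset.sum_neg_distrib]
  refine Finset.sum_congr rfl fun g _ => ?_
  simp

lemma form_neg_neg (α : X) : D.form (-α) (-α) = D.form α α := by
  unfold form
  refine Finset.sum_congr rfl fun g _ => ?_
  simp

lemma pair_mul_form {α : X} (h : α ∈ D.R) (x : X) :
    D.pair x (D.coroot α) * D.form α α = 2 * D.form x α := by
  have := D.form_refl h x α
  rw [D.refl_self h, refl_apply, form_sub_smul_neg] at this
  linarith

/-- isometries preserving the roots -/
def Isom (T : X →ₗ[ℤ] X) : Prop :=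
  (∀ x y, D.form (T x) (T y) = D.form x y) ∧ ∀ α ∈ D.R, T α ∈ D.R

variable {D} in
lemma Isom.pair {T : X →ₗ[ℤ] X} (hT : D.Isom T) {α : X} (h : α ∈ D.R) (x : X) :
    D.pair (T x) (D.coroot (T α)) = D.pair x (D.coroot α) := by
  have h1 := D.pair_mul_form (hT.2 α h) (T x)
  have h2 := D.pair_mul_form h x
  rw [hT.1, hT.1, ← h2] at h1
  exact mul_right_cancel₀ (D.form_pos h).ne' h1

variable {D} in
lemma Isom.refl {T : X →ₗ[ℤ] X} (hT : D.Isom T) {α : X} (h : α ∈ D.R) (x : X) :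
    D.refl (T α) (T x) = T (D.refl α x) := by
  rw [refl_apply, refl_apply, hT.pair h, map_sub, map_smul]

lemma isom_refl {α : X} (h : α ∈ D.R) : D.Isom (D.refl α) :=
  ⟨D.form_refl h, fun _ hb => D.refl_mem h hb⟩

lemma neg_mem_R {α : X} (h : α ∈ D.R) : -α ∈ D.R := by
  rw [← D.refl_self h]; exact D.refl_mem h h

lemma refl_neg {α : X} (h : α ∈ D.R) (x : X) : D.refl (-α) x = D.refl α x := by
  have h1 := D.pair_mul_form (D.neg_mem_R h) x
  have h2 := D.pair_mul_form h x
  rw [form_neg_neg, form_neg] at h1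
  have h3 : D.pair x (D.coroot (-α)) = - D.pair x (D.coroot α) := by
    apply mul_right_cancel₀ (D.form_pos h).ne'
    linarith
  rw [refl_apply, refl_apply, h3]; module

/-- words in reflections -/
def wd : List X → (X →ₗ[ℤ] X)
  | [] => LinearMap.id
  | a :: L => D.refl a ∘ₗ wd L

lemma wd_nil (x : X) : D.wd [] x = x := rfl

lemma wd_cons (a : X) (L : List X) (x : X) : D.wd (a :: L) x = D.refl a (D.wd L x) := rfl

lemma wd_append (L M : List X) (x : X) : D.wd (L ++ M) x = D.wd L (D.wd M x) := by
  induction L with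
  | nil => rfl
  | cons a L ih => rw [List.cons_append, wd_cons, wd_cons, ih]

lemma wd_reverse (L : List X) (hL : ∀ a ∈ L, a ∈ D.Δ) (x : X) :
    D.wd L.reverse (D.wd L x) = x := by
  induction L generalizing x with
  | nil => rfl
  | cons a L ih =>
    rw [List.reverse_cons, wd_append, wd_cons, wd_cons, wd_nil,
      D.refl_refl (D.delta_R (hL a (by simp)))]
    exact ih (fun b hb => hL b (by simp [hb])) x

lemma isom_wd (L : List X) (hL : ∀ a ∈ L, a ∈ D.Δ) : D.Isom (D.wd L) := by
  induction L with
  | nil => exact ⟨fun _ _ => rfl, fun _ h => h⟩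
  | cons a L ih =>
    have h1 := ih (fun b hb => hL b (by simp [hb]))
    have h2 := D.isom_refl (D.delta_R (hL a (by simp)))
    refine ⟨fun x y => ?_, fun α hα => ?_⟩
    · rw [wd_cons, wd_cons, h2.1, h1.1]
    · rw [wd_cons]; exact h2.2 _ (h1.2 _ hα)

lemma indep (c : X → ℤ) (h : ∑ β ∈ D.Δ, c β • β = 0) : ∀ β ∈ D.Δ, c β = 0 := by
  have := Fintype.linearIndependent_iff.mp D.simple_indep (fun b => c b) (by
    rw [← h]
    exact Finset.sum_coe_sort D.Δ (fun β => c β • β))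
  intro β hβ
  exact this ⟨β, hβ⟩

lemma sum_single [DecidableEq X] {α : X} (h : α ∈ D.Δ) (k : ℤ) :
    ∑ β ∈ D.Δ, (if β = α then k else 0) • β = k • α := by
  rw [Finset.sum_eq_single_of_mem α h]
  · simp
  · intro b _ hb; simp [hb]

lemma refl_pos {α β : X} (hα : α ∈ D.Δ) (hβ : β ∈ D.Rpos) (hne : β ≠ α) :
    D.refl α β ∈ D.Rpos := by
  classical
  rcases D.pos_or_neg _ (D.refl_mem (D.delta_R hα) (D.Rpos_subset hβ)) with h | h
  · exact h
  exfalso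
  obtain ⟨c, hc⟩ := D.pos_eq_nat_comb β hβ
  obtain ⟨d, hd⟩ := D.pos_eq_nat_comb _ h
  set k := D.pair β (D.coroot α) with hk
  have hz : ∑ γ ∈ D.Δ, ((c γ : ℤ) + d γ - if γ = α then k else 0) • γ = 0 := by
    simp only [sub_smul, add_smul, Finset.sum_sub_distrib, Finset.sum_add_distrib,
      D.sum_single hα, natCast_zsmul]
    rw [← hc, ← hd, refl_apply]; abel
  have h0 := D.indep _ hz
  have hcα : β = (c α : ℤ) • α := by
    conv_lhs => rw [hc]
    rw [Finset.sum_eq_single_of_mem α hα, natCast_zsmul]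
    intro b hb hbα
    have := h0 b hb
    simp only [hbα, if_false] at this
    have : c b = 0 := by omega
    simp [this]
  have hR := D.Rpos_subset hβ
  rw [hcα] at hR
  rcases D.reduced α (D.delta_R hα) _ hR with h1 | h1
  · rw [h1, one_smul] at hcα; exact hne hcα
  · omega

lemma form_sum_right (x : X) (c : X → ℕ) :
    D.form x (∑ β ∈ D.Δ, c β • β) = ∑ β ∈ D.Δ, (c β : ℤ) * D.form x β := by
  unfold form
  simp only [Finset.mul_sum]
  rw [Finset.sum_comm]
  refine Finset.sum_congr rfl fun g _ => ?_
  rw [map_sum, LinearMap.sum_apply, Finset.mul_sum]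
  refine Finset.sum_congr rfl fun b _ => ?_
  simp only [map_nsmul, LinearMap.smul_apply, nsmul_eq_mul]
  ring

lemma exists_pos_pair {β : X} (hβ : β ∈ D.Rpos) :
    ∃ α ∈ D.Δ, 0 < D.pair β (D.coroot α) := by
  by_contra! hcon
  obtain ⟨c, hc⟩ := D.pos_eq_nat_comb β hβ
  have h1 := D.form_pos (D.Rpos_subset hβ)
  have h2 : D.form β β = ∑ α ∈ D.Δ, (c α : ℤ) * D.form β α := by
    rw [← form_sum_right, ← hc]
  have h3 : ∑ α ∈ D.Δ, (c α : ℤ) * D.form β α ≤ 0 := by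
    refine Finset.sum_nonpos fun α hα => ?_
    have h4 := D.pair_mul_form (D.delta_R hα) β
    have h5 := D.form_pos (D.delta_R hα)
    have h6 := hcon α hα
    have : D.form β α ≤ 0 := by nlinarith
    exact mul_nonpos_of_nonneg_of_nonpos (by positivity) this
  omega

lemma root_word_aux (n : ℕ) : ∀ β ∈ D.Rpos, ∀ c : X → ℕ, β = ∑ γ ∈ D.Δ, c γ • γ →
    ∑ γ ∈ D.Δ, c γ ≤ n → ∃ L : List X, (∀ a ∈ L, a ∈ D.Δ) ∧ ∀ x, D.refl β x = D.wd L x := by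
  classical
  induction n with
  | zero =>
    intro β hβ c hc hs
    exfalso
    have h0 : ∑ γ ∈ D.Δ, c γ • γ = 0 := by
      refine Finset.sum_eq_zero fun γ hγ => ?_
      have := Finset.single_le_sum (f := c) (fun _ _ => Nat.zero_le _) hγ
      have : c γ = 0 := by omega
      simp [this]
    have h1 := D.pair_self β (D.Rpos_subset hβ)
    rw [← hc] at h0
    rw [h0] at h1
    simp at h1
  | succ n ih =>
    intro β hβ c hc hs
    obtain ⟨α, hα, hpos⟩ := D.exists_pos_pair hβ
    by_cases hne : β = α
    · refine ⟨[α], by simpa using hα, fun x => ?_⟩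
      rw [wd_cons, wd_nil, hne]
    have hβ' := D.refl_pos hα hβ hne
    obtain ⟨d, hd⟩ := D.pos_eq_nat_comb _ hβ'
    set k := D.pair β (D.coroot α) with hk
    have hz : ∑ γ ∈ D.Δ, ((c γ : ℤ) - d γ - if γ = α then k else 0) • γ = 0 := by
      simp only [sub_smul, Finset.sum_sub_distrib,
        D.sum_single hα, natCast_zsmul]
      rw [← hc, ← hd, refl_apply]; abel
    have h0 := Finset.sum_eq_zero (D.indep _ hz)
    simp only [Finset.sum_sub_distrib, Finset.sum_ite_eq', hα, if_true] at h0
    have h1 : ∑ γ ∈ D.Δ, d γ ≤ n := by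
      zify at hs ⊢
      linarith
    obtain ⟨L, hL, hLx⟩ := ih _ hβ' d hd h1
    refine ⟨α :: (L ++ [α]), ?_, fun x => ?_⟩
    · intro a ha
      simp only [List.mem_cons, List.mem_append, List.not_mem_nil, or_false] at ha
      rcases ha with rfl | ha | rfl
      · exact hα
      · exact hL a ha
      · exact hα
    · have h2 := (D.isom_refl (D.delta_R hα)).refl
        (D.refl_mem (D.delta_R hα) (D.Rpos_subset hβ)) (D.refl α x)
      rw [D.refl_refl (D.delta_R hα), D.refl_refl (D.delta_R hα)] at h2
      rw [wd_cons, wd_append, wd_cons, wd_nil, ← hLx, h2]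

lemma root_word {β : X} (hβ : β ∈ D.R) :
    ∃ L : List X, (∀ a ∈ L, a ∈ D.Δ) ∧ ∀ x, D.refl β x = D.wd L x := by
  rcases D.pos_or_neg β hβ with h | h
  · obtain ⟨c, hc⟩ := D.pos_eq_nat_comb β h
    exact D.root_word_aux _ β h c hc le_rfl
  · obtain ⟨c, hc⟩ := D.pos_eq_nat_comb _ h
    obtain ⟨L, hL, hx⟩ := D.root_word_aux _ _ h c hc le_rfl
    exact ⟨L, hL, fun x => by rw [← hx, D.refl_neg hβ]⟩

lemma weyl_word {w : X ≃ₗ[ℤ] X} (hw : w ∈ D.Weyl) :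
    ∃ L : List X, (∀ a ∈ L, a ∈ D.Δ) ∧ ∀ x, w x = D.wd L x := by
  unfold Weyl at hw
  induction hw using Subgroup.closure_induction with
  | mem w h =>
    obtain ⟨α, hα, h⟩ := h
    obtain ⟨L, hL, hx⟩ := D.root_word hα
    exact ⟨L, hL, fun x => by rw [← hx, h, refl_apply]⟩
  | one => exact ⟨[], by simp, fun x => rfl⟩
  | mul v w _ _ hv hw =>
    obtain ⟨L, hL, hx⟩ := hv
    obtain ⟨M, hM, hy⟩ := hw
    refine ⟨L ++ M, ?_, fun x => ?_⟩
    · intro a ha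
      rcases List.mem_append.mp ha with ha | ha
      · exact hL a ha
      · exact hM a ha
    · rw [wd_append, ← hy, ← hx]; rfl
  | inv w _ hw =>
    obtain ⟨L, hL, hx⟩ := hw
    refine ⟨L.reverse, fun a ha => hL a (List.mem_reverse.mp ha), fun x => ?_⟩
    have h1 := D.wd_reverse L hL (w⁻¹ x)
    rw [← hx] at h1
    rw [← h1]
    congr 1
    exact w.apply_symm_apply x

lemma exchange (L : List X) (hL : ∀ a ∈ L, a ∈ D.Δ) {α : X} (hα : α ∈ D.Δ)
    (hneg : - D.wd L α ∈ D.Rpos) :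
    ∃ L' : List X, (∀ a ∈ L', a ∈ D.Δ) ∧ L'.length < L.length ∧
      ∀ x, D.wd L x = D.wd L' (D.refl α x) := by
  induction L with
  | nil => exact absurd hneg (D.not_pos_and_neg α (D.Δ_subset hα))
  | cons a L ih =>
    have ha := hL a (by simp)
    have hL1 : ∀ b ∈ L, b ∈ D.Δ := fun b hb => hL b (by simp [hb])
    have hiso := D.isom_wd L hL1
    rcases D.pos_or_neg _ (hiso.2 α (D.delta_R hα)) with h | h
    · have heq : D.wd L α = a := by
        by_contra hne
        exact D.not_pos_and_neg _ (D.refl_pos ha h hne) hneg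
      refine ⟨L, hL1, by simp, fun x => ?_⟩
      rw [wd_cons, ← hiso.refl (D.delta_R hα), heq]
    · obtain ⟨L', h1, h2, h3⟩ := ih hL1 h
      refine ⟨a :: L', ?_, by simpa using h2, fun x => ?_⟩
      · intro b hb
        rcases List.mem_cons.mp hb with rfl | hb
        · exact ha
        · exact h1 b hb
      · rw [wd_cons, wd_cons, h3]

lemma sub_wd_mem {μ : X} (hμ : μ ∈ D.Xplus) (n : ℕ) : ∀ L : List X, (∀ a ∈ L, a ∈ D.Δ) →
    L.length = n → μ - D.wd L μ ∈ D.Qplus := by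
  induction n using Nat.strong_induction_on with
  | _ n ih =>
    intro L hL hn
    rcases List.eq_nil_or_concat L with rfl | ⟨L0, α, rfl⟩
    · simp [wd_nil]
    have hα : α ∈ D.Δ := hL α (by simp)
    have hL0 : ∀ b ∈ L0, b ∈ D.Δ := fun b hb => hL b (by simp [hb])
    simp only [List.length_append, List.length_singleton, List.concat_eq_append] at hn
    rw [List.concat_eq_append, wd_append, wd_cons, wd_nil]
    rcases D.pos_or_neg _ ((D.isom_wd L0 hL0).2 α (D.delta_R hα)) with h | h
    · have h1 := ih L0.length (by omega) L0 hL0 rfl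
      obtain ⟨k, hk⟩ := Int.eq_ofNat_of_zero_le (hμ α (D.Δ_subset hα))
      rw [refl_apply, hk, map_sub, map_smul]
      have : μ - (D.wd L0 μ - (k : ℤ) • D.wd L0 α) = (μ - D.wd L0 μ) + k • D.wd L0 α := by
        rw [natCast_zsmul]; abel
      rw [this]
      exact add_mem h1 (nsmul_mem (AddSubmonoid.subset_closure h) k)
    · obtain ⟨L', h1, h2, h3⟩ := D.exchange L0 hL0 hα h
      rw [h3, D.refl_refl (D.delta_R hα)]
      exact ih L'.length (by omega) L' h1 rfl

lemma sub_weyl_mem {μ : X} (hμ : μ ∈ D.Xplus) {w : X ≃ₗ[ℤ] X} (hw : w ∈ D.Weyl) :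
    μ - w μ ∈ D.Qplus := by
  obtain ⟨L, hL, hx⟩ := D.weyl_word hw
  rw [hx]
  exact D.sub_wd_mem hμ _ L hL rfl

lemma wd_faithful (n : ℕ) : ∀ L : List X, (∀ a ∈ L, a ∈ D.Δ) → L.length = n →
    (∀ α ∈ D.Δ, D.wd L α = α) → ∀ x, D.wd L x = x := by
  induction n using Nat.strong_induction_on with
  | _ n ih =>
    intro L hL hn hfix
    rcases List.eq_nil_or_concat L with rfl | ⟨L0, α, rfl⟩
    · intro x; rfl
    have hα : α ∈ D.Δ := hL α (by simp)
    have hL0 : ∀ b ∈ L0, b ∈ D.Δ := fun b hb => hL b (by simp [hb])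
    simp only [List.length_append, List.length_singleton, List.concat_eq_append] at hn
    have h1 := hfix α hα
    rw [List.concat_eq_append, wd_append, wd_cons, wd_nil, D.refl_self (D.delta_R hα),
      map_neg] at h1
    obtain ⟨L', h2, h3, h4⟩ := D.exchange L0 hL0 hα (by rw [h1]; exact D.Δ_subset hα)
    have h5 : ∀ x, D.wd (L0.concat α) x = D.wd L' x := by
      intro x
      rw [List.concat_eq_append, wd_append, wd_cons, wd_nil, h4, D.refl_refl (D.delta_R hα)]
    intro x
    rw [h5]
    refine ih L'.length (by omega) L' h2 rfl (fun β hβ => ?_) x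
    rw [← h5]; exact hfix β hβ

lemma weyl_root {w : X ≃ₗ[ℤ] X} (hw : w ∈ D.Weyl) {α : X} (h : α ∈ D.R) : w α ∈ D.R := by
  obtain ⟨L, hL, hx⟩ := D.weyl_word hw
  rw [hx]
  exact (D.isom_wd L hL).2 α h

lemma finite_weyl : Finite D.Weyl := by
  let φ : D.Weyl → ({x // x ∈ D.R} → {x // x ∈ D.R}) :=
    fun w r => ⟨w.1 r.1, D.weyl_root w.2 r.2⟩
  refine Finite.of_injective φ ?_
  intro v w h
  apply Subtype.ext
  obtain ⟨L, hL, hx⟩ := D.weyl_word (D.Weyl.mul_mem (D.Weyl.inv_mem w.2) v.2)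
  have h1 : ∀ α ∈ D.Δ, D.wd L α = α := by
    intro α hα
    rw [← hx]
    have h2 : v.1 α = w.1 α := congrArg Subtype.val (congrFun h ⟨α, D.delta_R hα⟩)
    change w.1.symm (v.1 α) = α
    rw [h2, w.1.symm_apply_apply]
  have h3 := D.wd_faithful _ L hL rfl h1
  ext x
  have h4 := h3 x
  rw [← hx] at h4
  change w.1.symm (v.1 x) = x at h4
  rw [← h4, w.1.apply_symm_apply, h4]

/-- sum of positive roots -/
def rho : X := ∑ β ∈ D.Rpos, β

lemma pair_rho {α : X} (hα : α ∈ D.Δ) : D.pair D.rho (D.coroot α) = 2 := by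
  classical
  have hR := D.delta_R hα
  unfold rho
  rw [map_sum, LinearMap.sum_apply, ← Finset.add_sum_erase _ _ (D.Δ_subset hα), D.pair_self α hR]
  have hmem : ∀ β ∈ D.Rpos.erase α, D.refl α β ∈ D.Rpos.erase α := by
    intro β hβ
    rw [Finset.mem_erase] at hβ ⊢
    refine ⟨fun h => ?_, D.refl_pos hα hβ.2 hβ.1⟩
    have h1 := D.refl_refl hR β
    rw [h, D.refl_self hR] at h1
    rw [← h1] at hβ
    exact D.not_pos_and_neg α (D.Δ_subset hα) hβ.2
  have : ∑ β ∈ D.Rpos.erase α, D.pair β (D.coroot α)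
      = ∑ β ∈ D.Rpos.erase α, - D.pair β (D.coroot α) := by
    refine Finset.sum_nbij' (fun β => D.refl α β) (fun β => D.refl α β) hmem hmem ?_ ?_ ?_
    · intro β _; exact D.refl_refl hR β
    · intro β _; exact D.refl_refl hR β
    · intro β _; rw [D.pair_refl hR, neg_neg]
  rw [Finset.sum_neg_distrib] at this
  omega

lemma exists_refl_weyl {α : X} (h : α ∈ D.R) : ∃ s ∈ D.Weyl, ∀ x, s x = D.refl α x := by
  refine ⟨LinearEquiv.ofInvolutive (D.refl α) (D.refl_refl h), ?_, fun x => rfl⟩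
  refine Subgroup.subset_closure ⟨α, h, fun x => ?_⟩
  exact D.refl_apply α x

lemma exists_dominant (F : X →ₗ[ℤ] ℝ) : ∃ w ∈ D.Weyl, ∀ α ∈ D.Δ, 0 ≤ F (w α) := by
  haveI := D.finite_weyl
  obtain ⟨w, hw⟩ := Finite.exists_max (fun w : D.Weyl => F (w.1 D.rho))
  refine ⟨w.1, w.2, fun α hα => ?_⟩
  obtain ⟨s, hs, hsx⟩ := D.exists_refl_weyl (D.delta_R hα)
  have h1 : F (w.1 (s D.rho)) ≤ F (w.1 D.rho) :=
    hw ⟨w.1 * s, D.Weyl.mul_mem w.2 hs⟩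
  rw [hsx, refl_apply, D.pair_rho hα] at h1
  simp only [map_sub, map_smul] at h1
  simp only [zsmul_eq_mul] at h1
  push_cast at h1
  linarith

lemma nonneg_Qplus (F : X →ₗ[ℤ] ℝ) (h : ∀ α ∈ D.Δ, 0 ≤ F α) {x : X} (hx : x ∈ D.Qplus) :
    0 ≤ F x := by
  unfold Qplus at hx
  induction hx using AddSubmonoid.closure_induction with
  | mem x hx =>
    obtain ⟨c, hc⟩ := D.pos_eq_nat_comb x hx
    rw [hc, map_sum]
    refine Finset.sum_nonneg fun β hβ => ?_
    rw [map_nsmul]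
    exact nsmul_nonneg (h β hβ) _
  | zero => simp
  | add x y _ _ hx hy => rw [map_add]; exact add_nonneg hx hy

/-- the real cone spanned by simple roots -/
def rcone : Set (ℝ ⊗[ℤ] X) :=
  {v | ∃ c : X → ℝ, (∀ β : X, 0 ≤ c β) ∧ v = ∑ β ∈ D.Δ, c β • toReal X β}

lemma rcone_add {v w : ℝ ⊗[ℤ] X} (hv : v ∈ D.rcone) (hw : w ∈ D.rcone) : v + w ∈ D.rcone := by
  obtain ⟨c, hc, rfl⟩ := hv
  obtain ⟨d, hd, rfl⟩ := hw
  refine ⟨c + d, fun β => add_nonneg (hc β) (hd β), ?_⟩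
  simp only [Pi.add_apply, add_smul, Finset.sum_add_distrib]

lemma rcone_smul {v : ℝ ⊗[ℤ] X} (hv : v ∈ D.rcone) {a : ℝ} (ha : 0 ≤ a) : a • v ∈ D.rcone := by
  obtain ⟨c, hc, rfl⟩ := hv
  refine ⟨fun β => a * c β, fun β => mul_nonneg ha (hc β), ?_⟩
  simp only [mul_smul, Finset.smul_sum]

lemma Qplus_rcone {x : X} (hx : x ∈ D.Qplus) : toReal X x ∈ D.rcone := by
  unfold Qplus at hx
  induction hx using AddSubmonoid.closure_induction with
  | mem x hx =>
    obtain ⟨c, hc⟩ := D.pos_eq_nat_comb x hx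
    refine ⟨fun β => c β, fun β => by positivity, ?_⟩
    conv_lhs => rw [hc]
    rw [map_sum]
    refine Finset.sum_congr rfl fun β _ => ?_
    rw [map_nsmul, Nat.cast_smul_eq_nsmul]
  | zero => exact ⟨0, fun _ => le_rfl, by simp⟩
  | add x y _ _ hx hy => rw [map_add]; exact D.rcone_add hx hy

lemma finite_orbit (ν : X) : (D.WOrbit ν).Finite := by
  haveI := D.finite_weyl
  refine (Set.finite_range (fun w : D.Weyl => w.1 ν)).subset ?_
  rintro x ⟨w, hw, rfl⟩
  exact ⟨⟨w, hw⟩, rfl⟩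

end helpers

/-- Separation of a point from the hull of a finite set in a finite-dimensional space. -/
lemma separate {V : Type*} [AddCommGroup V] [Module ℝ V] [Module.Finite ℝ V]
    (s : Set V) (hs : s.Finite) (x : V) (hx : x ∉ convexHull ℝ s) :
    ∃ f : V →ₗ[ℝ] ℝ, ∀ y ∈ s, f y < f x := by
  let e := (Module.finBasis ℝ V).equivFun
  have h1 : e x ∉ convexHull ℝ (e '' s) := by
    intro h
    have h2 := (LinearMap.image_convexHull e.toLinearMap s)
    simp only [LinearEquiv.coe_coe] at h2
    rw [← h2] at h
    obtain ⟨y, hy, hyx⟩ := h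
    exact hx (e.injective hyx ▸ hy)
  have hc : IsClosed (convexHull ℝ (e '' s)) := (hs.image e).isClosed_convexHull ℝ
  obtain ⟨f, u, hf1, hf2⟩ := geometric_hahn_banach_closed_point (convex_convexHull ℝ _) hc h1
  refine ⟨f.toLinearMap ∘ₗ e.toLinearMap, fun y hy => ?_⟩
  exact (hf1 _ (subset_convexHull ℝ _ ⟨y, hy, rfl⟩)).trans hf2

end RootDatumBase

/-- For dominant `λ, μ ∈ X₊`: `λ ⪯ μ` iff `λ ⊗ 1 ∈ Conv(Wμ)`,
i.e. `λ` lies in the convex hull of the Weyl orbit of `μ` in `X ⊗ ℝ` exactly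
when `μ - λ` is a nonnegative real combination of simple roots. -/
theorem weak_order_iff_mem_convexHull
    {X Xv : Type} [AddCommGroup X] [AddCommGroup Xv]
    [Module.Free ℤ X] [Module.Finite ℤ X]
    (D : RootDatumBase X Xv)
    (l m : X) (hl : l ∈ D.Xplus) (hm : m ∈ D.Xplus) :
    D.dpreceq l m ↔ RootDatumBase.toReal X l ∈ D.ConvW m := by
  constructor
  · rintro ⟨c, hc, hcm⟩
    by_contra hcon
    obtain ⟨f, hf⟩ := RootDatumBase.separate _ ((D.finite_orbit m).image _) _ hcon
    let F : X →ₗ[ℤ] ℝ := (f.restrictScalars ℤ) ∘ₗ RootDatumBase.toReal X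
    have hF : ∀ w ∈ D.Weyl, F (w m) < F l := fun w hw =>
      hf _ ⟨w m, ⟨w, hw, rfl⟩, rfl⟩
    obtain ⟨w, hw, hpos⟩ := D.exists_dominant F
    let F' : X →ₗ[ℤ] ℝ := F ∘ₗ w.toLinearMap
    let f' : ℝ ⊗[ℤ] X →ₗ[ℝ] ℝ := (TensorProduct.isBaseChange ℤ X ℝ).lift F'
    have hf' : ∀ x, f' (RootDatumBase.toReal X x) = F' x := fun x =>
      (TensorProduct.isBaseChange ℤ X ℝ).lift_eq F' x
    have h1 : 0 ≤ F' (m - l) := by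
      rw [← hf', hcm, map_sum]
      refine Finset.sum_nonneg fun β hβ => ?_
      rw [map_smul, hf', smul_eq_mul]
      exact mul_nonneg (hc β) (hpos β hβ)
    have h2 : 0 ≤ F' (l - w⁻¹ l) :=
      D.nonneg_Qplus F' hpos (D.sub_weyl_mem hl (D.Weyl.inv_mem hw))
    have h3 : F' (w⁻¹ l) = F l := congrArg F (w.apply_symm_apply l)
    have h4 : F' m < F l := hF w hw
    rw [map_sub] at h1 h2
    linarith
  · intro h
    have hsub : D.ConvW m ⊆ {x | RootDatumBase.toReal X m - x ∈ D.rcone} := by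
      refine convexHull_min ?_ ?_
      · rintro _ ⟨x, ⟨w, hw, rfl⟩, rfl⟩
        have := D.Qplus_rcone (D.sub_weyl_mem hm hw)
        rwa [map_sub] at this
      · intro x hx y hy a b ha hb hab
        have h1 := D.rcone_add (D.rcone_smul hx ha) (D.rcone_smul hy hb)
        have h2 : RootDatumBase.toReal X m - (a • x + b • y)
            = a • (RootDatumBase.toReal X m - x) + b • (RootDatumBase.toReal X m - y) := by
          have : b = 1 - a := by linarith
          subst this
          module
        change _ ∈ D.rcone
        rwa [h2]
    obtain ⟨c, hc, h1⟩ := hsub h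
    exact ⟨c, hc, by rw [map_sub]; exact h1⟩
end

section
/- If λ, μ ∈ X₊ are dominant elements with λ ⪯ μ, then there exists a finite subset F ⊆ X₊ such that for every integer k ≥ 1 and every dominant ν ∈ X₊ with ν ⪯ kλ, there exist f ∈ F, w ∈ W and w₁, …, w_k ∈ W such that ν = w(f) + Σ_{i=1}^{k} w_i(μ). (That is, for all k the set of dominant elements ⪯ kλ is contained in W·F + Wμ + ⋯ + Wμ, with k summands Wμ.) -/
open scoped TensorProduct

namespace RootDatumBase

variable {X Xv : Type} [AddCommGroup X] [AddCommGroup Xv] (D : RootDatumBase X Xv)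

/-- Reindexing sums over coroots along a dual reflection. -/
lemma sum_coreflect {A : Type*} [AddCommMonoid A] (g : Xv → A) {α : X} (hα : α ∈ D.R) :
    ∑ γ ∈ D.Rv, g (γ - D.pair α γ • D.coroot α) = ∑ γ ∈ D.Rv, g γ := by
  have h2 := D.pair_self α hα
  have inv : ∀ γ : Xv, (γ - D.pair α γ • D.coroot α) -
      D.pair α (γ - D.pair α γ • D.coroot α) • D.coroot α = γ := by
    intro γ
    simp only [map_sub, map_smul, h2, smul_eq_mul]
    rw [sub_smul, mul_smul, two_smul, smul_add]
    abel
  refine Finset.sum_bij' (fun γ _ => γ - D.pair α γ • D.coroot α)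
    (fun γ _ => γ - D.pair α γ • D.coroot α) ?_ ?_ ?_ ?_ ?_
  · intro γ hγ; exact D.coreflect_mem α hα γ hγ
  · intro γ hγ; exact D.coreflect_mem α hα γ hγ
  · intro γ _; exact inv γ
  · intro γ _; exact inv γ
  · intro γ _; rfl

/-- The polarization sends a root to a positive multiple of its coroot. -/
lemma two_polarization {α : X} (hα : α ∈ D.R) :
    (2 : ℤ) • ∑ γ ∈ D.Rv, D.pair α γ • γ =
      (∑ γ ∈ D.Rv, D.pair α γ ^ 2) • D.coroot α := by
  have h2 := D.pair_self α hα
  have h := D.sum_coreflect (fun γ => D.pair α γ • γ) hα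
  have h' : ∑ γ ∈ D.Rv, D.pair α (γ - D.pair α γ • D.coroot α) • (γ - D.pair α γ • D.coroot α)
      = (∑ γ ∈ D.Rv, D.pair α γ ^ 2) • D.coroot α - ∑ γ ∈ D.Rv, D.pair α γ • γ := by
    rw [Finset.sum_smul, ← Finset.sum_sub_distrib]
    refine Finset.sum_congr rfl fun γ _ => ?_
    simp only [map_sub, map_smul, h2, smul_eq_mul]
    module
  rw [h'] at h
  rw [two_smul]
  exact (sub_eq_iff_eq_add.mp h).symm

/-- The reflection as a linear equivalence. -/
lemma exists_reflection {α : X} (hα : α ∈ D.R) :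
    ∃ w ∈ D.Weyl, ∀ x : X, w x = x - D.pair x (D.coroot α) • α := by
  have h : (D.pair.flip (D.coroot α)) α = 2 := D.pair_self α hα
  have key : ∀ x : X, Module.reflection h x = x - D.pair x (D.coroot α) • α := by
    intro x; simp [Module.reflection_apply]
  exact ⟨Module.reflection h, Subgroup.subset_closure ⟨α, hα, key⟩, key⟩

lemma weyl_form {w : X ≃ₗ[ℤ] X} (hw : w ∈ D.Weyl) :
    ∀ x, ∑ γ ∈ D.Rv, D.pair (w x) γ ^ 2 = ∑ γ ∈ D.Rv, D.pair x γ ^ 2 := by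
  induction hw using Subgroup.closure_induction with
  | mem w hw =>
    obtain ⟨α, hα, h⟩ := hw
    intro x
    rw [← D.sum_coreflect (fun γ => D.pair x γ ^ 2) hα]
    refine Finset.sum_congr rfl fun γ _ => ?_
    rw [h]
    simp only [map_sub, map_smul, LinearMap.sub_apply, LinearMap.smul_apply, smul_eq_mul]
    ring
  | one => intro x; rfl
  | mul a b _ _ ha hb => intro x; rw [LinearEquiv.mul_apply, ha, hb]
  | inv a _ ha =>
    intro x
    rw [← ha (a⁻¹ x)]
    have e : a (a⁻¹ x) = x := by change a (a.symm x) = x; simp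
    rw [e]

lemma weyl_sub {w : X ≃ₗ[ℤ] X} (hw : w ∈ D.Weyl) :
    ∀ x, w x - x ∈ Submodule.span ℤ (D.R : Set X) := by
  induction hw using Subgroup.closure_induction with
  | mem w hw =>
    obtain ⟨α, hα, h⟩ := hw
    intro x
    rw [h, sub_sub_cancel_left]
    exact neg_mem (Submodule.smul_mem _ _ (Submodule.subset_span hα))
  | one => intro x; simp
  | mul a b _ _ ha hb =>
    intro x
    rw [LinearEquiv.mul_apply, ← sub_add_sub_cancel]
    exact add_mem (ha _) (hb _)
  | inv a _ ha =>
    intro x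
    have := neg_mem (ha (a⁻¹ x))
    have e : a (a⁻¹ x) = x := by change a (a.symm x) = x; simp
    rw [e, neg_sub] at this
    exact this

lemma nondeg [Module.Free ℤ X] {v : X} (hv : v ∈ Submodule.span ℤ (D.R : Set X))
    (h0 : ∀ γ ∈ D.Rv, D.pair v γ = 0) : v = 0 := by
  have : D.pair.IsPerfPair := ⟨D.perfect_left, D.perfect_right⟩
  let P : RootPairing D.R ℤ X Xv := RootPairing.mk' D.pair
    (Function.Embedding.subtype _) ⟨fun a => D.coroot a.1, fun a b h =>
      Subtype.ext (D.coroot_bijOn.injOn a.2 b.2 h)⟩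
    (fun i => D.pair_self _ i.2)
    (by
      rintro i - ⟨j, rfl⟩
      exact ⟨⟨_, D.reflect_mem i i.2 j j.2⟩, rfl⟩)
    (by
      rintro i - ⟨j, rfl⟩
      have := D.coreflect_mem i i.2 _ (D.coroot_bijOn.mapsTo j.2)
      obtain ⟨a, ha, h⟩ := D.coroot_bijOn.surjOn this
      exact ⟨⟨a, ha⟩, h⟩)
  apply P.eq_zero_of_mem_rootSpan_of_rootForm_self_eq_zero
  · have : Set.range P.root = (D.R : Set X) := by
      ext x; constructor
      · rintro ⟨a, rfl⟩; exact a.2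
      · intro hx; exact ⟨⟨x, hx⟩, rfl⟩
    unfold RootPairing.rootSpan
    rw [this]; exact hv
  · rw [RootPairing.rootForm_apply_apply]
    refine Finset.sum_eq_zero fun i _ => ?_
    have : P.coroot' i v = 0 := h0 _ (D.coroot_bijOn.mapsTo i.2)
    rw [this]; simp

lemma orbit_finite [Module.Free ℤ X] (x : X) : (D.WOrbit x).Finite := by
  classical
  let N : ℤ := ∑ γ ∈ D.Rv, D.pair x γ ^ 2
  let e : X → (D.Rv → ℤ) := fun y γ => D.pair y γ
  refine Set.Finite.of_finite_image (f := e)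
    ((Set.finite_Icc (fun _ => -N) (fun _ => N)).subset ?_) ?_
  · rintro _ ⟨y, ⟨w, hw, rfl⟩, rfl⟩
    have key : ∀ γ : D.Rv, -N ≤ e (w x) γ ∧ e (w x) γ ≤ N := by
      intro γ
      have h1 : D.pair (w x) γ ^ 2 ≤ N := by
        rw [← show ∑ γ ∈ D.Rv, D.pair (w x) γ ^ 2 = N from D.weyl_form hw x]
        exact Finset.single_le_sum (f := fun γ => D.pair (w x) γ ^ 2)
          (fun _ _ => sq_nonneg _) γ.2
      change -N ≤ D.pair (w x) γ ∧ D.pair (w x) γ ≤ N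
      have h3 : |D.pair (w x) γ| ≤ D.pair (w x) γ ^ 2 := by
        rw [← sq_abs]
        have h0 := abs_nonneg (D.pair (w x) γ)
        rcases h0.eq_or_lt with h | h
        · rw [← h]; simp
        · nlinarith
      exact abs_le.mp (h3.trans h1)
    exact ⟨fun γ => (key γ).1, fun γ => (key γ).2⟩
  · rintro _ ⟨w, hw, rfl⟩ _ ⟨w', hw', rfl⟩ h
    rw [← sub_eq_zero]
    apply D.nondeg
    · rw [← sub_sub_sub_cancel_right _ _ x]
      exact sub_mem (D.weyl_sub hw x) (D.weyl_sub hw' x)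
    · intro γ hγ
      have := congrFun h ⟨γ, hγ⟩
      simp only [map_sub, LinearMap.sub_apply, sub_eq_zero]
      exact this

lemma simple_mem {β : X} (hβ : β ∈ D.Δ) : β ∈ D.R := D.Rpos_subset (D.Δ_subset hβ)

lemma exists_height [Module.Free ℤ X] : ∃ y : D.Δ → ℝ, ∀ α ∈ D.Δ,
    ∑ β : D.Δ, y β * (D.pair α (D.coroot β) : ℝ) = 1 := by
  classical
  let A : Matrix D.Δ D.Δ ℤ := fun α β => D.pair α (D.coroot β)
  have hdet : A.det ≠ 0 := by
    intro h
    obtain ⟨n, hn, h0⟩ := Matrix.exists_vecMul_eq_zero_iff.mpr h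
    apply hn
    set v : X := ∑ α : D.Δ, n α • (α : X) with hv
    have hv0 : ∀ β : D.Δ, D.pair v (D.coroot β) = 0 := by
      intro β
      have := congrFun h0 β
      simpa [Matrix.vecMul, dotProduct, A, hv, LinearMap.sum_apply] using this
    have hB : ∀ β : D.Δ, ∑ γ ∈ D.Rv, D.pair β γ * D.pair v γ = 0 := by
      intro β
      have := congrArg (D.pair v) (D.two_polarization (D.simple_mem β.2))
      simp only [map_smul, map_sum, hv0, smul_eq_mul, mul_zero] at this
      simpa using this
    have hvv : ∑ γ ∈ D.Rv, D.pair v γ * D.pair v γ = 0 := by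
      have : ∀ γ, D.pair v γ * D.pair v γ = ∑ β : D.Δ, n β * (D.pair β γ * D.pair v γ) := by
        intro γ
        nth_rewrite 1 [hv]
        simp [LinearMap.sum_apply, Finset.sum_mul, mul_assoc]
      simp_rw [this]
      rw [Finset.sum_comm]
      refine Finset.sum_eq_zero fun β _ => ?_
      rw [← Finset.mul_sum, hB, mul_zero]
    have hz := (Finset.sum_eq_zero_iff_of_nonneg (fun γ _ => mul_self_nonneg _)).mp hvv
    have hv' : v = 0 := by
      apply D.nondeg
      · exact sum_mem fun α _ => Submodule.smul_mem _ _ (Submodule.subset_span (D.simple_mem α.2))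
      · intro γ hγ; exact mul_self_eq_zero.mp (hz γ hγ)
    funext i
    exact Fintype.linearIndependent_iff.mp D.simple_indep n hv' i
  let A' : Matrix D.Δ D.Δ ℝ := A.map (fun z => (z : ℝ))
  have hdet' : IsUnit A'.det := by
    have : A'.det = (A.det : ℝ) := (Int.cast_det A).symm
    rw [this]
    exact isUnit_iff_ne_zero.mpr (by exact_mod_cast hdet)
  refine ⟨A'⁻¹.mulVec (fun _ => 1), fun α hα => ?_⟩
  have h : A'.mulVec (A'⁻¹.mulVec (fun _ => 1)) = fun _ => 1 := by
    rw [Matrix.mulVec_mulVec, Matrix.mul_nonsing_inv _ hdet', Matrix.one_mulVec]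
  have := congrFun h ⟨α, hα⟩
  exact (Finset.sum_congr rfl fun β _ => mul_comm _ _).trans this

lemma exists_dom [Module.Free ℤ X] (x : X) : ∃ f ∈ D.Xplus, ∃ w ∈ D.Weyl, x = w f := by
  obtain ⟨y, hy⟩ := D.exists_height
  let h : X →+ ℝ :=
    { toFun := fun x => ∑ β : D.Δ, y β * (D.pair x (D.coroot β) : ℝ)
      map_zero' := by simp
      map_add' := by intro a b; simp [mul_add, Finset.sum_add_distrib] }
  have hh : ∀ α ∈ D.Δ, h α = 1 := hy
  obtain ⟨f, ⟨w, hw, rfl⟩, hmax⟩ :=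
    Set.exists_max_image (D.WOrbit x) h (D.orbit_finite x) ⟨x, 1, one_mem _, rfl⟩
  refine ⟨w x, ?_, w⁻¹, inv_mem hw, ?_⟩
  · intro α hα
    by_contra! hneg
    obtain ⟨s, hs, hs'⟩ := D.exists_reflection (D.Rpos_subset hα)
    have h1 := hmax (s (w x)) ⟨s * w, mul_mem hs hw, rfl⟩
    rw [hs', map_sub, map_zsmul] at h1
    have hpos : 0 < h α := by
      obtain ⟨c, hc⟩ := D.pos_eq_nat_comb α hα
      have e : h α = ∑ β ∈ D.Δ, (c β : ℝ) := by
        rw [hc, map_sum]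
        refine Finset.sum_congr rfl fun β hβ => ?_
        rw [map_nsmul, hh β hβ]; simp
      have hnn : 0 ≤ h α := by rw [e]; positivity
      refine lt_of_le_of_ne hnn fun h0 => ?_
      rw [e] at h0
      have hz := (Finset.sum_eq_zero_iff_of_nonneg (fun β _ => by positivity)).mp h0.symm
      have : α = 0 := by
        rw [hc]
        refine Finset.sum_eq_zero fun β hβ => ?_
        have : c β = 0 := by exact_mod_cast hz β hβ
        simp [this]
      have h2 := D.pair_self α (D.Rpos_subset hα)
      rw [this] at h2
      simp at h2
    have : (D.pair (w x) (D.coroot α) : ℝ) < 0 := by exact_mod_cast hneg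
    rw [zsmul_eq_mul] at h1
    nlinarith
  · change x = w.symm (w x); simp

end RootDatumBase

namespace RootDatumBase

variable {X Xv : Type} [AddCommGroup X] [AddCommGroup Xv] (D : RootDatumBase X Xv)

/-- Positivity: a nonzero nonnegative combination of simple roots pairs positively with the
coroot of some simple root in its support. -/
lemma exists_pos_pairing [Module.Free ℤ X] {E : Type*} [AddCommGroup E] [Module ℝ E]
    (j : X →+ E) (P : Xv →+ (E →ₗ[ℝ] ℝ)) (hP : ∀ γ x, P γ (j x) = (D.pair x γ : ℝ))
    (d : D.Δ → ℝ) (hd : ∀ β, 0 ≤ d β) (hne : 0 < ∑ β, d β) :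
    ∃ β : D.Δ, 0 < d β ∧ 0 < P (D.coroot β) (∑ α : D.Δ, d α • j α) := by
  by_contra! hcon
  set v := ∑ α : D.Δ, d α • j α with hv
  have hB : ∀ β : D.Δ, d β * ∑ γ ∈ D.Rv, (D.pair β γ : ℝ) * P γ v ≤ 0 := by
    intro β
    rcases (hd β).eq_or_lt with h0 | hpos
    · rw [← h0, zero_mul]
    · have h1 := hcon β hpos
      have h2 := congrArg (fun γ => P γ v) (D.two_polarization (D.simple_mem β.2))
      simp only [map_zsmul, map_sum, LinearMap.smul_apply, LinearMap.sum_apply,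
        zsmul_eq_mul] at h2
      have h3 : (0 : ℝ) ≤ ((∑ γ ∈ D.Rv, D.pair β γ ^ 2 : ℤ) : ℝ) := by
        exact Int.cast_nonneg (Finset.sum_nonneg fun γ _ => sq_nonneg _)
      have h4 := mul_nonpos_of_nonneg_of_nonpos h3 h1
      rw [← h2] at h4
      push_cast at h4
      have h5 : ∑ γ ∈ D.Rv, (D.pair β γ : ℝ) * P γ v ≤ 0 := by linarith
      exact mul_nonpos_of_nonneg_of_nonpos hpos.le h5
  have hvv : ∑ γ ∈ D.Rv, P γ v * P γ v ≤ 0 := by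
    have : ∀ γ, P γ v * P γ v = ∑ β : D.Δ, d β * ((D.pair β γ : ℝ) * P γ v) := by
      intro γ
      nth_rewrite 1 [hv]
      simp [map_sum, hP, Finset.sum_mul, mul_assoc]
    simp_rw [this]
    rw [Finset.sum_comm]
    refine Finset.sum_nonpos fun β _ => ?_
    rw [← Finset.mul_sum]
    exact hB β
  have hz := (Finset.sum_eq_zero_iff_of_nonneg (fun γ _ => mul_self_nonneg _)).mp
    (le_antisymm hvv (Finset.sum_nonneg fun γ _ => mul_self_nonneg _))
  obtain ⟨y, hy⟩ := D.exists_height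
  have h1 : ∑ β : D.Δ, y β * P (D.coroot β) v = ∑ β, d β := by
    have : ∀ β : D.Δ, y β * P (D.coroot β) v =
        ∑ α : D.Δ, d α * (y β * (D.pair α (D.coroot β) : ℝ)) := by
      intro β
      rw [hv, map_sum, Finset.mul_sum]
      refine Finset.sum_congr rfl fun α _ => ?_
      rw [map_smul, hP, smul_eq_mul]; ring
    simp_rw [this]
    rw [Finset.sum_comm]
    refine Finset.sum_congr rfl fun α _ => ?_
    rw [← Finset.mul_sum, hy α α.2, mul_one]
  have h2 : ∑ β : D.Δ, y β * P (D.coroot β) v = 0 := by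
    refine Finset.sum_eq_zero fun β _ => ?_
    rw [mul_self_eq_zero.mp (hz _ (D.coroot_bijOn.mapsTo (D.simple_mem β.2))), mul_zero]
  linarith

lemma mem_of_dom [Module.Free ℤ X] {ι : Type} [Fintype ι]
    (j : X →+ (ι → ℝ)) (P : Xv →+ ((ι → ℝ) →ₗ[ℝ] ℝ))
    (hP : ∀ γ x, P γ (j x) = (D.pair x γ : ℝ))
    {S : Set (ι → ℝ)} (hconv : Convex ℝ S) (hcomp : IsCompact S)
    (hst : ∀ β ∈ D.Δ, ∀ x ∈ S, x - P (D.coroot β) x • j β ∈ S)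
    {ν : X} (hν : ν ∈ D.Xplus) (c : D.Δ → ℝ) (hc : ∀ β, 0 ≤ c β)
    (hmem : j ν + ∑ β : D.Δ, c β • j β ∈ S) : j ν ∈ S := by
  classical
  obtain ⟨y, hy⟩ := D.exists_height
  let φ : (D.Δ → ℝ) → (ι → ℝ) := fun d => j ν + ∑ β : D.Δ, d β • j β
  have hφ : Continuous φ := by fun_prop
  let h : (ι → ℝ) →ₗ[ℝ] ℝ := ∑ β : D.Δ, y β • P (D.coroot β)
  have hh : ∀ α : D.Δ, h (j α) = 1 := by
    intro α
    simp only [h, LinearMap.sum_apply, LinearMap.smul_apply, hP, smul_eq_mul]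
    exact hy α α.2
  have hcont : Continuous h := h.continuous_of_finiteDimensional
  have hhφ : ∀ d, h (φ d) = h (j ν) + ∑ β, d β := by
    intro d
    simp only [φ, map_add, map_sum, map_smul, hh, smul_eq_mul, mul_one]
  obtain ⟨M, hM⟩ := (hcomp.image hcont).bddAbove
  let K : Set (D.Δ → ℝ) := {d | (∀ β, 0 ≤ d β) ∧ φ d ∈ S}
  have hKcl : IsClosed K := by
    exact (isClosed_Ici (a := (0 : D.Δ → ℝ))).inter (hcomp.isClosed.preimage hφ)
  have hKc : IsCompact K := by
    refine (isCompact_Icc (a := (0 : D.Δ → ℝ)) (b := fun _ => M - h (j ν))).of_isClosed_subset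
      hKcl ?_
    rintro d ⟨hd, hdS⟩
    refine ⟨hd, fun β => ?_⟩
    have h1 := hM ⟨_, hdS, rfl⟩
    rw [hhφ] at h1
    have h2 := Finset.single_le_sum (f := d) (fun β _ => hd β) (Finset.mem_univ β)
    change d β ≤ M - h (j ν)
    linarith
  obtain ⟨d, ⟨hd, hdS⟩, hmin⟩ := hKc.exists_isMinOn ⟨c, hc, hmem⟩
    (f := fun d => ∑ β, d β) (by fun_prop)
  rcases (Finset.sum_nonneg (fun β _ => hd β) : 0 ≤ ∑ β, d β).eq_or_lt with h0 | hpos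
  · have hz := (Finset.sum_eq_zero_iff_of_nonneg (fun β _ => hd β)).mp h0.symm
    have : φ d = j ν := by
      simp only [φ, add_eq_left]
      exact Finset.sum_eq_zero fun β hβ => by rw [hz β hβ, zero_smul]
    rwa [← this]
  · exfalso
    obtain ⟨β, hβ, hβ'⟩ := D.exists_pos_pairing j P hP d hd hpos
    have hp : 0 < P (D.coroot β) (φ d) := by
      have h1 : (0 : ℝ) ≤ P (D.coroot β) (j ν) := by
        rw [hP]; exact_mod_cast hν β (D.Δ_subset β.2)
      simp only [φ, map_add]
      linarith
    set p := φ d with hpd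
    set q := P (D.coroot β) p with hq
    let t := min (d β) q
    have ht : 0 < t := lt_min hβ hp
    have htq : t ≤ q := min_le_right _ _
    have hmem' : p - t • j β ∈ S := by
      have := hconv hdS (hst β β.2 p hdS) (a := 1 - t / q) (b := t / q)
        (by rw [sub_nonneg, div_le_one hp]; exact htq) (by positivity) (by ring)
      convert this using 1
      rw [smul_sub, smul_smul, div_mul_cancel₀ _ hp.ne']
      module
    have hup : φ (Function.update d β (d β - t)) = p - t • j β := by
      rw [hpd]
      simp only [φ]
      rw [← Finset.add_sum_erase _ _ (Finset.mem_univ β),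
        ← Finset.add_sum_erase (a := β) _ (fun α : D.Δ => d α • j (α : X)) (Finset.mem_univ β)]
      have : ∑ x ∈ Finset.univ.erase β, Function.update d β (d β - t) x • j (x : X) =
          ∑ x ∈ Finset.univ.erase β, d x • j (x : X) := by
        refine Finset.sum_congr rfl fun x hx => ?_
        rw [Function.update_of_ne (Finset.ne_of_mem_erase hx)]
      rw [this, Function.update_self]
      module
    have hK' : Function.update d β (d β - t) ∈ K := by
      refine ⟨fun α => ?_, ?_⟩
      · by_cases hα : α = β
        · subst hα
          rw [Function.update_self, sub_nonneg]
          exact min_le_left _ _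
        · rw [Function.update_of_ne hα]; exact hd α
      · rw [hup]; exact hmem'
    have h1 := hmin hK'
    change ∑ β, d β ≤ ∑ α, Function.update d β (d β - t) α at h1
    have h2 := hhφ (Function.update d β (d β - t))
    have h3 := hhφ d
    rw [hup, map_sub, map_smul, hh, smul_eq_mul, mul_one] at h2
    rw [← hpd] at h3
    linarith

/-- sums of `k` elements of the orbit of `m` -/
lemma exists_list_of_mult {m : X} (O : Finset X) (hO : ∀ o ∈ O, o ∈ D.WOrbit m) (n : X → ℕ) :
    ∃ L : List (X ≃ₗ[ℤ] X), (∀ w ∈ L, w ∈ D.Weyl) ∧ L.length = ∑ o ∈ O, n o ∧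
      (L.map (fun w => w m)).sum = ∑ o ∈ O, n o • o := by
  classical
  induction O using Finset.induction_on with
  | empty => exact ⟨[], by simp, by simp, by simp⟩
  | insert a s ha ih =>
    obtain ⟨L, h1, h2, h3⟩ := ih fun o ho => hO o (Finset.mem_insert_of_mem ho)
    obtain ⟨w, hw, hwa⟩ := hO a (Finset.mem_insert_self _ _)
    refine ⟨List.replicate (n a) w ++ L, ?_, ?_, ?_⟩
    · intro u hu
      rcases List.mem_append.mp hu with h | h
      · rw [List.eq_of_mem_replicate h]; exact hw
      · exact h1 u h
    · simp [h2, Finset.sum_insert ha]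
    · rw [Finset.sum_insert ha, List.map_append, List.sum_append, h3, List.map_replicate,
        List.sum_replicate, ← hwa]

end RootDatumBase

/-- Proposition B.3 (ii) ⇒ (iii). If `λ, μ ∈ X₊` with `λ ⪯ μ`, then
there is a finite `F ⊆ X₊` such that for every `k ≥ 1` and every dominant `ν ⪯ kλ`
one has `ν = w f + ∑ᵢ wᵢ μ` with `f ∈ F` and `w, w₁, …, w_k ∈ W`. -/
theorem dom_le_subset_weyl_sum
    {X Xv : Type} [AddCommGroup X] [AddCommGroup Xv]
    [Module.Free ℤ X] [Module.Finite ℤ X]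
    (D : RootDatumBase X Xv)
    (l m : X) (hl : l ∈ D.Xplus) (hm : m ∈ D.Xplus) (hlm : D.dpreceq l m) :
    ∃ F : Finset X, ↑F ⊆ D.Xplus ∧
      ∀ k : ℕ, 1 ≤ k → ∀ ν ∈ D.Xplus, D.dpreceq ν (k • l) →
        ∃ f ∈ F, ∃ w ∈ D.Weyl, ∃ ws : Fin k → (X ≃ₗ[ℤ] X),
          (∀ i : Fin k, ws i ∈ D.Weyl) ∧ ν = w f + ∑ i : Fin k, ws i m := by
  classical
  let b := Module.Free.chooseBasis ℤ X
  let ι := Module.Free.ChooseBasisIndex ℤ X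
  let j : X →+ (ι → ℝ) :=
    { toFun := fun x i => (b.repr x i : ℝ)
      map_zero' := by ext i; simp
      map_add' := by intro x y; ext i; simp }
  have hj : ∀ x i, j x i = (b.repr x i : ℝ) := fun _ _ => rfl
  let P : Xv →+ ((ι → ℝ) →ₗ[ℝ] ℝ) :=
    { toFun := fun γ => ∑ i, (D.pair (b i) γ : ℝ) • LinearMap.proj i
      map_zero' := by simp
      map_add' := by intro x y; simp [add_smul, Finset.sum_add_distrib] }
  have hP : ∀ γ x, P γ (j x) = (D.pair x γ : ℝ) := by
    intro γ x
    have e : D.pair x γ = ∑ i, b.repr x i * D.pair (b i) γ := by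
      conv_lhs => rw [← b.sum_repr x]
      simp only [map_sum, map_smul, LinearMap.sum_apply, LinearMap.smul_apply, smul_eq_mul]
    rw [e]
    push_cast
    simp only [P, AddMonoidHom.coe_mk, ZeroHom.coe_mk, LinearMap.sum_apply, LinearMap.smul_apply,
      LinearMap.proj_apply, smul_eq_mul, hj]
    exact Finset.sum_congr rfl fun i _ => mul_comm _ _
  let T : (ℝ ⊗[ℤ] X) →ₗ[ℝ] (ι → ℝ) :=
    (TensorProduct.isBaseChange ℤ X ℝ).lift j.toIntLinearMap
  have hT : ∀ x, T (RootDatumBase.toReal X x) = j x := fun x =>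
    IsBaseChange.lift_eq _ j.toIntLinearMap x
  have hprec : ∀ x y, D.dpreceq x y → ∃ c : X → ℝ, (∀ β, 0 ≤ c β) ∧
      j y = j x + ∑ β ∈ D.Δ, c β • j β := by
    rintro x y ⟨c, hc, h⟩
    refine ⟨c, hc, ?_⟩
    have := congrArg T h
    rw [hT, map_sub, map_sum] at this
    simp only [map_smul, hT] at this
    rw [← this]; abel
  obtain ⟨c, hc, hlm'⟩ := hprec l m hlm
  let O : Finset X := (D.orbit_finite m).toFinset
  have hO : ∀ o, o ∈ O ↔ o ∈ D.WOrbit m := fun o => Set.Finite.mem_toFinset _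
  have hmO : m ∈ O := (hO m).mpr ⟨1, one_mem _, rfl⟩
  let C : Set (ι → ℝ) := convexHull ℝ ((O.image j : Finset (ι → ℝ)) : Set (ι → ℝ))
  have hCc : IsCompact C := (Finset.finite_toSet _).isCompact_convexHull ℝ
  have hCconv : Convex ℝ C := convex_convexHull ℝ _
  have hst : ∀ β ∈ D.Δ, ∀ x ∈ C, x - P (D.coroot β) x • j β ∈ C := by
    intro β hβ x hx
    let s : (ι → ℝ) →ₗ[ℝ] (ι → ℝ) := LinearMap.id - (P (D.coroot β)).smulRight (j β)
    have hs : ∀ x, s x = x - P (D.coroot β) x • j β := fun x => rfl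
    rw [← hs]
    have h1 : s x ∈ s '' C := ⟨x, hx, rfl⟩
    rw [LinearMap.image_convexHull] at h1
    refine convexHull_mono ?_ h1
    rintro _ ⟨_, hz, rfl⟩
    obtain ⟨o, ho, rfl⟩ := Finset.mem_image.mp (Finset.mem_coe.mp hz)
    obtain ⟨w, hw, rfl⟩ := (hO o).mp ho
    obtain ⟨r, hr, hr'⟩ := D.exists_reflection (D.simple_mem hβ)
    refine Finset.mem_coe.mpr (Finset.mem_image.mpr ⟨r (w m), ?_, ?_⟩)
    · exact (hO _).mpr ⟨r * w, mul_mem hr hw, rfl⟩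
    · rw [hs, hP, hr', map_sub, map_zsmul]
      simp [Int.cast_smul_eq_zsmul]
  let N : ι → ℝ := fun i => ∑ o ∈ O, |j o i| + O.card * |j m i|
  have hG : {x : X | ∀ i, |j x i| ≤ N i}.Finite := by
    refine Set.Finite.of_finite_image (f := fun x => (fun i => b.repr x i : ι → ℤ))
      ((Set.finite_Icc (fun i => -⌈N i⌉) (fun i => ⌈N i⌉)).subset ?_) ?_
    · rintro _ ⟨x, hx, rfl⟩
      have key : ∀ i, |b.repr x i| ≤ ⌈N i⌉ := by
        intro i
        have := (hx i).trans (Int.le_ceil (N i))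
        rw [hj] at this
        exact_mod_cast this
      exact ⟨fun i => (abs_le.mp (key i)).1, fun i => (abs_le.mp (key i)).2⟩
    · intro x _ y _ hxy
      apply b.repr.injective
      ext i
      exact congrFun hxy i
  choose dom hdom wd hwd hdomeq using D.exists_dom
  refine ⟨hG.toFinset.image dom, ?_, ?_⟩
  · intro f hf
    obtain ⟨x, _, rfl⟩ := Finset.mem_image.mp (Finset.mem_coe.mp hf)
    exact hdom x
  intro k hk ν hν hνk
  obtain ⟨c', hc', hνk'⟩ := hprec _ _ hνk
  open scoped Pointwise in
  have hmemS : j ν ∈ (k : ℝ) • C := by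
    refine D.mem_of_dom j P hP (hCconv.smul _) (hCc.smul _) ?_ hν
      (fun β => c' β + k * c β) (fun β => add_nonneg (hc' _) (mul_nonneg (by positivity) (hc _))) ?_
    · rintro β hβ _ ⟨x, hx, rfl⟩
      refine ⟨_, hst β hβ x hx, ?_⟩
      simp only [smul_sub, map_smul, smul_smul, smul_eq_mul]
    · refine ⟨j m, subset_convexHull ℝ _ (Finset.mem_coe.mpr (Finset.mem_image_of_mem j hmO)), ?_⟩
      change (k : ℝ) • j m = _
      have e1 : j (k • l) = (k : ℝ) • j l := by rw [map_nsmul, Nat.cast_smul_eq_nsmul]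
      have e2 : (k : ℝ) • ∑ β ∈ D.Δ, c β • j β = ∑ β ∈ D.Δ, ((k : ℝ) * c β) • j β := by
        simp [Finset.smul_sum, smul_smul]
      rw [hlm', smul_add, ← e1, hνk', e2, add_assoc, ← Finset.sum_add_distrib]
      congr 1
      rw [← Finset.sum_coe_sort D.Δ]
      refine Finset.sum_congr rfl fun β _ => ?_
      rw [add_smul]
  have hjinj : Function.Injective j := by
    intro x y hxy
    apply b.repr.injective
    ext i
    have := congrFun hxy i
    rw [hj, hj] at this
    exact_mod_cast this
  obtain ⟨a, ha0, hasum, haν⟩ : ∃ a : X → ℝ, (∀ o ∈ O, 0 ≤ a o) ∧ ∑ o ∈ O, a o = k ∧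
      j ν = ∑ o ∈ O, a o • j o := by
    obtain ⟨x, hx, hxν⟩ := hmemS
    obtain ⟨u, hu0, hu1, hux⟩ := Finset.mem_convexHull'.mp hx
    rw [Finset.sum_image (fun _ _ _ _ h => hjinj h)] at hu1 hux
    refine ⟨fun o => k * u (j o), fun o ho => ?_, ?_, ?_⟩
    · exact mul_nonneg (by positivity) (hu0 _ (Finset.mem_image_of_mem j ho))
    · rw [← Finset.mul_sum, hu1, mul_one]
    · rw [← hxν, ← hux]
      simp [Finset.smul_sum, smul_smul]
  let n : X → ℕ := fun o => ⌊a o⌋₊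
  have hn1 : ∀ o ∈ O, (n o : ℝ) ≤ a o := fun o ho => Nat.floor_le (ha0 o ho)
  have hn2 : ∀ o ∈ O, a o - n o ≤ 1 := fun o _ => by
    have := Nat.lt_floor_add_one (a o)
    simp only [n]; linarith
  have hnk : ∑ o ∈ O, n o ≤ k := by
    have : ((∑ o ∈ O, n o : ℕ) : ℝ) ≤ k := by
      rw [← hasum]; push_cast
      exact Finset.sum_le_sum hn1
    exact_mod_cast this
  obtain ⟨r, hr⟩ := Nat.exists_eq_add_of_le hnk
  have hrO : (r : ℝ) ≤ O.card := by
    have h1 : (k : ℝ) = ∑ o ∈ O, (n o : ℝ) + r := by rw [hr]; push_cast; rfl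
    have h2 : ∑ o ∈ O, (a o - n o) ≤ O.card := by
      simpa using Finset.sum_le_sum hn2
    rw [Finset.sum_sub_distrib, hasum] at h2
    linarith
  obtain ⟨L, hL1, hL2, hL3⟩ := D.exists_list_of_mult O (fun o ho => (hO o).mp ho) n
  let L' := L ++ List.replicate r (1 : X ≃ₗ[ℤ] X)
  have hL'len : L'.length = k := by simp [L', hL2, hr]
  have hL'W : ∀ w ∈ L', w ∈ D.Weyl := by
    intro w hw
    rcases List.mem_append.mp hw with h | h
    · exact hL1 w h
    · rw [List.eq_of_mem_replicate h]; exact one_mem _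
  have hL'sum : (L'.map (fun w => w m)).sum = ∑ o ∈ O, n o • o + r • m := by
    simp [L', hL3]
  set x := ν - (∑ o ∈ O, n o • o + r • m) with hx
  have hxG : x ∈ hG.toFinset := by
    rw [Set.Finite.mem_toFinset]
    intro i
    have e : j x i = ∑ o ∈ O, (a o - n o) * j o i - r * j m i := by
      rw [hx, map_sub, haν, map_add, map_sum]
      simp [sub_mul, Finset.sum_sub_distrib]
      ring
    rw [e]
    refine (abs_sub _ _).trans (add_le_add ?_ ?_)
    · refine (Finset.abs_sum_le_sum_abs _ _).trans (Finset.sum_le_sum fun o ho => ?_)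
      rw [abs_mul, abs_of_nonneg (sub_nonneg.mpr (hn1 o ho))]
      exact mul_le_of_le_one_left (abs_nonneg _) (hn2 o ho)
    · rw [abs_mul, Nat.abs_cast]
      exact mul_le_mul_of_nonneg_right hrO (abs_nonneg _)
  refine ⟨dom x, Finset.mem_image_of_mem dom hxG, wd x, hwd x,
    fun i => L'.get (i.cast hL'len.symm), fun i => hL'W _ (List.get_mem _ _), ?_⟩
  rw [← hdomeq x]
  have : ∑ i : Fin k, (L'.get (i.cast hL'len.symm)) m = (L'.map (fun w => w m)).sum := by
    clear_value L'
    subst hL'len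
    rw [← Fin.sum_univ_fun_getElem]
    rfl
  rw [this, hL'sum, hx]
  abel
end

section
/- Any isomorphism of the partially ordered monoids of dominant elements extends to an isomorphism of based root data: if f : X₊ → X'₊ is a bijection with f(λ + μ) = f(λ) + f(μ) for all λ, μ ∈ X₊ and such that λ ≤ μ if and only if f(λ) ≤' f(μ), then there is a unique group isomorphism e : X → X' with e(λ) = f(λ) for all λ ∈ X₊, and this e maps Δ bijectively onto Δ', maps R bijectively onto R', and preserves the pairings with coroots: ⟨e(x), e(α)^∨⟩ = ⟨x, α^∨⟩ for all x ∈ X and α ∈ R, where e(α)^∨ ∈ X'^∨ denotes the coroot of e(α) ∈ R'. -/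
open scoped TensorProduct

namespace RootDatumBase

section Aux

variable {X Xv : Type} [AddCommGroup X] [AddCommGroup Xv] (D : RootDatumBase X Xv)

/-- the associated Mathlib root pairing -/
noncomputable def toRP [Module.Free ℤ X] : RootPairing {x // x ∈ D.R} ℤ X Xv :=
  haveI : D.pair.IsPerfPair := ⟨D.perfect_left, D.perfect_right⟩
  RootPairing.mk' D.pair ⟨fun i => (i : X), Subtype.val_injective⟩
    ⟨fun i => D.coroot i, fun i j h => Subtype.ext (D.coroot_bijOn.injOn i.2 j.2 h)⟩
    (fun i => D.pair_self i i.2)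
    (by
      rintro i _ ⟨j, rfl⟩
      exact ⟨⟨_, D.reflect_mem i i.2 j j.2⟩, by rw [Module.preReflection_apply]; rfl⟩)
    (by
      rintro i _ ⟨j, rfl⟩
      obtain ⟨k, hk, hk'⟩ := D.coroot_bijOn.surjOn
        (D.coreflect_mem i i.2 _ (D.coroot_bijOn.mapsTo j.2))
      exact ⟨⟨k, hk⟩, by rw [Module.preReflection_apply]; exact hk'⟩)

theorem coroot_reflect [Module.Free ℤ X] {α β : X} (hα : α ∈ D.R) (hβ : β ∈ D.R) :
    D.coroot (β - D.pair β (D.coroot α) • α) =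
      D.coroot β - D.pair α (D.coroot β) • D.coroot α := by
  have h1 := D.toRP.reflectionPerm_root ⟨α, hα⟩ ⟨β, hβ⟩
  have h2 := D.toRP.reflectionPerm_coroot ⟨α, hα⟩ ⟨β, hβ⟩
  have h1' : β - D.pair β (D.coroot α) • α = (D.toRP.reflectionPerm ⟨α, hα⟩ ⟨β, hβ⟩ : X) := h1
  have h2' : D.coroot β - D.pair α (D.coroot β) • D.coroot α =
    D.coroot (D.toRP.reflectionPerm ⟨α, hα⟩ ⟨β, hβ⟩ : X) := h2
  rw [h1', h2']

theorem pair_pos_iff [Module.Free ℤ X] {α β : X} (hα : α ∈ D.R) (hβ : β ∈ D.R) :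
    0 < D.pair α (D.coroot β) ↔ 0 < D.pair β (D.coroot α) := by
  have h := D.toRP.zero_lt_pairingIn_iff' (S := ℤ) (i := ⟨α, hα⟩) (j := ⟨β, hβ⟩)
  have e1 : D.toRP.pairingIn ℤ ⟨α, hα⟩ ⟨β, hβ⟩ = D.pair α (D.coroot β) :=
    D.toRP.algebraMap_pairingIn ℤ ⟨α, hα⟩ ⟨β, hβ⟩
  have e2 : D.toRP.pairingIn ℤ ⟨β, hβ⟩ ⟨α, hα⟩ = D.pair β (D.coroot α) :=
    D.toRP.algebraMap_pairingIn ℤ ⟨β, hβ⟩ ⟨α, hα⟩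
  rwa [e1, e2] at h

theorem neg_mem {α : X} (hα : α ∈ D.R) : -α ∈ D.R := by
  have h := D.reflect_mem α hα α hα
  rw [D.pair_self α hα] at h
  have : α - (2 : ℤ) • α = -α := by module
  rwa [this] at h

theorem coroot_neg [Module.Free ℤ X] {α : X} (hα : α ∈ D.R) :
    D.coroot (-α) = - D.coroot α := by
  have h := D.coroot_reflect hα hα
  rw [D.pair_self α hα] at h
  have e1 : α - (2 : ℤ) • α = -α := by module
  have e2 : D.coroot α - (2 : ℤ) • D.coroot α = -D.coroot α := by module
  rwa [e1, e2] at h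

theorem mem_R_of_Δ {α : X} (hα : α ∈ D.Δ) : α ∈ D.R := D.Rpos_subset (D.Δ_subset hα)

theorem ne_zero_of_mem {α : X} (hα : α ∈ D.R) : α ≠ 0 := by
  rintro rfl
  simpa using D.pair_self 0 hα

theorem coeff_unique {c d : X → ℤ} (h : ∑ β ∈ D.Δ, c β • β = ∑ β ∈ D.Δ, d β • β) :
    ∀ β ∈ D.Δ, c β = d β := by
  intro β hβ
  rw [← Finset.sum_coe_sort, ← Finset.sum_coe_sort D.Δ (fun β => d β • β)] at h
  exact Fintype.linearIndependent_iffₛ.mp D.simple_indep (fun i => c i) (fun i => d i) h ⟨β, hβ⟩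

theorem coeff_unique_nat {c d : X → ℕ} (h : ∑ β ∈ D.Δ, c β • β = ∑ β ∈ D.Δ, d β • β) :
    ∀ β ∈ D.Δ, c β = d β := by
  intro β hβ
  have := D.coeff_unique (c := fun x => (c x : ℤ)) (d := fun x => (d x : ℤ))
    (by simpa using h) β hβ
  exact_mod_cast this

theorem reflect_pos {α β : X} (hα : α ∈ D.Δ) (hβ : β ∈ D.Rpos) (hne : β ≠ α) :
    β - D.pair β (D.coroot α) • α ∈ D.Rpos := by
  classical
  rcases D.pos_or_neg _ (D.reflect_mem α (D.mem_R_of_Δ hα) β (D.Rpos_subset hβ)) with h | h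
  · exact h
  exfalso
  obtain ⟨c, hc⟩ := D.pos_eq_nat_comb β hβ
  obtain ⟨d, hd⟩ := D.pos_eq_nat_comb _ h
  set k := D.pair β (D.coroot α) with hk
  have hs : ∑ γ ∈ D.Δ, ((c γ : ℤ) + d γ) • γ = ∑ γ ∈ D.Δ, (if γ = α then k else 0) • γ := by
    simp only [add_smul, Finset.sum_add_distrib, natCast_zsmul, ← hc, ← hd, ite_smul, zero_smul,
      Finset.sum_ite_eq', hα, if_true]
    abel
  have hu := D.coeff_unique hs
  have hc0 : ∀ γ ∈ D.Δ, γ ≠ α → c γ = 0 := by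
    intro γ hγ hγα
    have := hu γ hγ
    simp only [hγα, if_false] at this
    lia
  rw [Finset.sum_eq_single_of_mem α hα (fun γ hγ h => by simp [hc0 γ hγ h])] at hc
  have hr := D.reduced α (D.mem_R_of_Δ hα) (c α) (by
    rw [natCast_zsmul, ← hc]; exact D.Rpos_subset hβ)
  have : c α = 1 := by lia
  rw [this, one_smul] at hc
  exact hne hc

theorem pos_induction [Module.Free ℤ X] {P : X → Prop} (h1 : ∀ α ∈ D.Δ, P α)
    (h2 : ∀ α ∈ D.Δ, ∀ β ∈ D.Rpos, 0 < D.pair α (D.coroot β) →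
      β - D.pair β (D.coroot α) • α ∈ D.Rpos →
      P (β - D.pair β (D.coroot α) • α) → P β) : ∀ β ∈ D.Rpos, P β := by
  classical
  suffices H : ∀ n : ℕ, ∀ β ∈ D.Rpos, ∀ c : X → ℕ, β = ∑ γ ∈ D.Δ, c γ • γ →
      ∑ γ ∈ D.Δ, c γ = n → P β by
    intro β hβ
    obtain ⟨c, hc⟩ := D.pos_eq_nat_comb β hβ
    exact H _ β hβ c hc rfl
  intro n
  induction n using Nat.strongRecOn with
  | ind n ih =>
    intro β hβ c hc hn
    by_cases hβΔ : β ∈ D.Δ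
    · exact h1 β hβΔ
    obtain ⟨α, hα, hpos⟩ : ∃ α ∈ D.Δ, 0 < D.pair α (D.coroot β) := by
      by_contra! hcon
      have h3 := D.pair_self β (D.Rpos_subset hβ)
      have h4 : D.pair β (D.coroot β) = ∑ γ ∈ D.Δ, (c γ : ℤ) * D.pair γ (D.coroot β) := by
        conv_lhs => enter [1]; rw [hc]
        simp
      have h5 : ∑ γ ∈ D.Δ, (c γ : ℤ) * D.pair γ (D.coroot β) ≤ 0 :=
        Finset.sum_nonpos fun γ hγ => mul_nonpos_of_nonneg_of_nonpos (by positivity) (hcon γ hγ)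
      lia
    have hne : β ≠ α := fun h => hβΔ (h ▸ hα)
    have hr := D.reflect_pos hα hβ hne
    have hk := (D.pair_pos_iff (D.mem_R_of_Δ hα) (D.Rpos_subset hβ)).1 hpos
    refine h2 α hα β hβ hpos hr ?_
    obtain ⟨d, hd⟩ := D.pos_eq_nat_comb _ hr
    refine ih _ ?_ _ hr d hd rfl
    set k := D.pair β (D.coroot α) with hkdef
    have hs : ∑ γ ∈ D.Δ, (d γ : ℤ) • γ = ∑ γ ∈ D.Δ, ((c γ : ℤ) - if γ = α then k else 0) • γ := by
      simp only [sub_smul, Finset.sum_sub_distrib, natCast_zsmul, ← hc, ← hd, ite_smul, zero_smul,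
        Finset.sum_ite_eq', hα, if_true]
    have hu := Finset.sum_congr rfl (D.coeff_unique hs)
    rw [Finset.sum_sub_distrib, Finset.sum_ite_eq', if_pos hα] at hu
    have : ((∑ γ ∈ D.Δ, d γ : ℕ) : ℤ) < (n : ℤ) := by
      rw [← hn]; push_cast; lia
    exact_mod_cast this

theorem coroot_pos [Module.Free ℤ X] :
    ∀ β ∈ D.Rpos, D.coroot β ∈ AddSubmonoid.closure (Set.image D.coroot (D.Δ : Set X)) := by
  refine D.pos_induction
    (P := fun β => D.coroot β ∈ AddSubmonoid.closure (Set.image D.coroot (D.Δ : Set X))) ?_ ?_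
  · intro α hα
    exact AddSubmonoid.subset_closure ⟨α, hα, rfl⟩
  · intro α hα β hβ hpos hr ih
    rw [D.coroot_reflect (D.mem_R_of_Δ hα) (D.Rpos_subset hβ)] at ih
    obtain ⟨k, hk⟩ := Int.eq_ofNat_of_zero_le hpos.le
    have : D.coroot β = (D.coroot β - D.pair α (D.coroot β) • D.coroot α) + k • D.coroot α := by
      rw [hk]; simp
    rw [this]
    have hmem : D.coroot α ∈ AddSubmonoid.closure (Set.image D.coroot (D.Δ : Set X)) :=
      AddSubmonoid.subset_closure ⟨α, hα, rfl⟩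
    exact add_mem ih (nsmul_mem hmem k)

theorem mem_Xplus_iff [Module.Free ℤ X] {x : X} :
    x ∈ D.Xplus ↔ ∀ α ∈ D.Δ, 0 ≤ D.pair x (D.coroot α) := by
  refine ⟨fun h α hα => h α (D.Δ_subset hα), fun h β hβ => ?_⟩
  refine AddSubmonoid.closure_induction (motive := fun y _ => 0 ≤ D.pair x y) ?_ ?_ ?_
    (D.coroot_pos β hβ)
  · rintro _ ⟨α, hα, rfl⟩
    exact h α hα
  · simp
  · intro y z _ _ hy hz
    rw [map_add]; exact add_nonneg hy hz

/-- the sum of the positive roots -/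
def rho2 : X := ∑ β ∈ D.Rpos, β

theorem pair_rho2 [Module.Free ℤ X] {α : X} (hα : α ∈ D.Δ) :
    D.pair D.rho2 (D.coroot α) = 2 := by
  classical
  have hαR := D.mem_R_of_Δ hα
  have hαα := D.pair_self α hαR
  set s : X → X := fun x => x - D.pair x (D.coroot α) • α with hs
  have hinv : ∀ x, s (s x) = x := by
    intro x
    simp only [hs, map_sub, map_smul, LinearMap.sub_apply, LinearMap.smul_apply, hαα, smul_eq_mul]
    module
  have hsα : s α = -α := by simp only [hs, hαα]; module
  have hmem : ∀ x ∈ D.Rpos.erase α, s x ∈ D.Rpos.erase α := by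
    intro x hx
    obtain ⟨hne, hx⟩ := Finset.mem_erase.1 hx
    refine Finset.mem_erase.2 ⟨fun h => ?_, D.reflect_pos hα hx hne⟩
    have : x = -α := by rw [← hinv x, h, hsα]
    exact D.not_pos_and_neg α (D.Δ_subset hα) (this ▸ hx)
  have hsum : ∑ x ∈ D.Rpos.erase α, s x = ∑ x ∈ D.Rpos.erase α, x :=
    Finset.sum_bij' (fun x _ => s x) (fun x _ => s x) hmem hmem (fun x _ => hinv x)
      (fun x _ => hinv x) (fun x _ => rfl)
  set t := ∑ x ∈ D.Rpos.erase α, x with ht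
  have h0 : D.pair t (D.coroot α) • α = 0 := by
    have : ∑ x ∈ D.Rpos.erase α, s x = t - D.pair t (D.coroot α) • α := by
      simp only [hs, Finset.sum_sub_distrib, ← Finset.sum_smul, ht, map_sum, LinearMap.sum_apply]
    rw [this] at hsum
    simpa using hsum
  have h1 : D.pair t (D.coroot α) = 0 := by
    rcases smul_eq_zero.1 h0 with h | h
    · exact h
    · exact absurd h (D.ne_zero_of_mem hαR)
  have h2 : D.rho2 = t + α := (Finset.sum_erase_add _ _ (D.Δ_subset hα)).symm
  rw [h2, map_add, LinearMap.add_apply, h1, hαα, zero_add]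

theorem add_mem_Xplus {x y : X} (hx : x ∈ D.Xplus) (hy : y ∈ D.Xplus) : x + y ∈ D.Xplus := by
  intro α hα
  rw [map_add, LinearMap.add_apply]
  exact add_nonneg (hx α hα) (hy α hα)

theorem zero_mem_Xplus : (0 : X) ∈ D.Xplus := by
  intro α hα
  simp

theorem exists_shift [Module.Free ℤ X] (x : X) : ∃ a ∈ D.Xplus, x + a ∈ D.Xplus := by
  have hn : ∀ n : ℕ, n • D.rho2 ∈ D.Xplus := by
    intro n
    rw [mem_Xplus_iff]
    intro α hα
    rw [map_nsmul, LinearMap.smul_apply, D.pair_rho2 hα]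
    positivity
  refine ⟨(∑ α ∈ D.Δ, (D.pair x (D.coroot α)).natAbs) • D.rho2, hn _, ?_⟩
  rw [mem_Xplus_iff]
  intro α hα
  rw [map_add, map_nsmul, LinearMap.add_apply, LinearMap.smul_apply, D.pair_rho2 hα]
  have h1 := Finset.single_le_sum (f := fun α => (D.pair x (D.coroot α)).natAbs)
    (fun _ _ => Nat.zero_le _) hα
  simp only [nsmul_eq_mul] at h1 ⊢
  lia

theorem hom_ext [Module.Free ℤ X] {Y : Type} [AddCommGroup Y] {g h : X →+ Y}
    (H : ∀ l ∈ D.Xplus, g l = h l) : g = h := by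
  ext x
  obtain ⟨a, ha, hxa⟩ := D.exists_shift x
  have := H _ hxa
  rw [map_add, map_add, H a ha] at this
  exact add_right_cancel this

theorem exists_hom [Module.Free ℤ X] {Y : Type} [AddCommGroup Y] (f : X → Y)
    (hadd : ∀ l ∈ D.Xplus, ∀ m ∈ D.Xplus, f (l + m) = f l + f m) :
    ∃ e : X →+ Y, ∀ l ∈ D.Xplus, e l = f l := by
  choose a ha hxa using D.exists_shift
  have key : ∀ x b, b ∈ D.Xplus → x + b ∈ D.Xplus →
      f (x + a x) - f (a x) = f (x + b) - f b := by
    intro x b hb hxb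
    have h1 := hadd _ (hxa x) _ hb
    have h2 := hadd _ hxb _ (ha x)
    rw [show x + b + a x = x + a x + b by abel, h1] at h2
    rw [sub_eq_sub_iff_add_eq_add, h2]
  have hzero : f 0 = 0 := by
    have := hadd 0 D.zero_mem_Xplus 0 D.zero_mem_Xplus
    simpa using this
  refine ⟨AddMonoidHom.mk' (fun x => f (x + a x) - f (a x)) ?_, ?_⟩
  · intro x y
    have h1 : (x + y) + (a x + a y) = (x + a x) + (y + a y) := by abel
    have h2 := key (x + y) (a x + a y) (D.add_mem_Xplus (ha x) (ha y))
      (h1 ▸ D.add_mem_Xplus (hxa x) (hxa y))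
    rw [h1, hadd _ (hxa x) _ (hxa y), hadd _ (ha x) _ (ha y)] at h2
    rw [h2]; abel
  · intro l hl
    have := key l 0 D.zero_mem_Xplus (by simpa using hl)
    simpa [hzero] using this

theorem mem_Qplus_iff {x : X} : x ∈ D.Qplus ↔ ∃ c : X → ℕ, x = ∑ β ∈ D.Δ, c β • β := by
  constructor
  · intro h
    refine AddSubmonoid.closure_induction (motive := fun y _ => ∃ c : X → ℕ, y = ∑ β ∈ D.Δ, c β • β)
      ?_ ?_ ?_ h
    · intro y hy
      exact D.pos_eq_nat_comb y hy
    · exact ⟨fun _ => 0, by simp⟩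
    · rintro y z _ _ ⟨c, hc⟩ ⟨d, hd⟩
      exact ⟨fun x => c x + d x, by rw [hc, hd]; simp [add_smul, Finset.sum_add_distrib]⟩
  · rintro ⟨c, rfl⟩
    exact sum_mem fun β hβ => nsmul_mem (AddSubmonoid.subset_closure (D.Δ_subset hβ)) _

theorem mem_Δ_iff {α : X} : α ∈ D.Δ ↔ α ∈ D.Qplus ∧ α ≠ 0 ∧
    ∀ a ∈ D.Qplus, ∀ b ∈ D.Qplus, α = a + b → a = 0 ∨ b = 0 := by
  classical
  constructor
  · intro hα
    refine ⟨AddSubmonoid.subset_closure (D.Δ_subset hα), D.ne_zero_of_mem (D.mem_R_of_Δ hα), ?_⟩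
    intro a ha b hb hab
    obtain ⟨c, hc⟩ := D.mem_Qplus_iff.1 ha
    obtain ⟨d, hd⟩ := D.mem_Qplus_iff.1 hb
    have hs : ∑ γ ∈ D.Δ, (c γ + d γ) • γ = ∑ γ ∈ D.Δ, (if γ = α then 1 else 0) • γ := by
      simp only [add_smul, Finset.sum_add_distrib, ← hc, ← hd, ← hab, ite_smul, zero_smul,
        one_smul, Finset.sum_ite_eq', hα, if_true]
    have hu := D.coeff_unique_nat hs
    have hα1 := hu α hα
    simp only [if_true] at hα1
    rcases Nat.eq_zero_or_pos (c α) with h0 | h0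
    · left
      rw [hc]
      refine Finset.sum_eq_zero fun γ hγ => ?_
      have : c γ = 0 := by
        by_cases h : γ = α
        · rw [h, h0]
        · have := hu γ hγ
          simp only [h, if_false] at this
          lia
      rw [this, zero_smul]
    · right
      rw [hd]
      refine Finset.sum_eq_zero fun γ hγ => ?_
      have : d γ = 0 := by
        by_cases h : γ = α
        · rw [h]; lia
        · have := hu γ hγ
          simp only [h, if_false] at this
          lia
      rw [this, zero_smul]
  · rintro ⟨hQ, h0, hind⟩
    obtain ⟨c, hc⟩ := D.mem_Qplus_iff.1 hQ
    obtain ⟨γ, hγ, hcγ⟩ : ∃ γ ∈ D.Δ, c γ ≠ 0 := by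
      by_contra! hcon
      exact h0 (by rw [hc]; exact Finset.sum_eq_zero fun γ hγ => by simp [hcon γ hγ])
    obtain ⟨m, hm⟩ := Nat.exists_eq_succ_of_ne_zero hcγ
    have hγQ : γ ∈ D.Qplus := AddSubmonoid.subset_closure (D.Δ_subset hγ)
    have hsplit : α = γ + (m • γ + ∑ β ∈ D.Δ.erase γ, c β • β) := by
      rw [hc, ← Finset.add_sum_erase _ _ hγ, hm, Nat.succ_eq_add_one, add_smul, one_smul]
      abel
    rcases hind γ hγQ _ (add_mem (nsmul_mem hγQ m) (sum_mem fun β hβ => nsmul_mem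
      (AddSubmonoid.subset_closure (D.Δ_subset (Finset.mem_of_mem_erase hβ))) _)) hsplit with h | h
    · exact absurd h (D.ne_zero_of_mem (D.mem_R_of_Δ hγ))
    · rw [h, add_zero] at hsplit
      rw [hsplit]; exact hγ

theorem two_smul_sub_mem_iff [Module.Free ℤ X] {α l : X} (hα : α ∈ D.Δ) (hl : l ∈ D.Xplus)
    {k : ℤ} (hk : 0 ≤ k) :
    (2 : ℤ) • l - k • α ∈ D.Xplus ↔ k ≤ D.pair l (D.coroot α) := by
  rw [mem_Xplus_iff]
  have hform : ∀ β, D.pair ((2 : ℤ) • l - k • α) (D.coroot β) =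
      2 * D.pair l (D.coroot β) - k * D.pair α (D.coroot β) := by
    intro β
    simp only [map_sub, map_smul, LinearMap.sub_apply, LinearMap.smul_apply, smul_eq_mul]
  constructor
  · intro h
    have := h α hα
    rw [hform, D.pair_self α (D.mem_R_of_Δ hα)] at this
    lia
  · intro h β hβ
    rw [hform]
    by_cases hne : α = β
    · subst hne
      rw [D.pair_self α (D.mem_R_of_Δ hα)]
      lia
    · have h1 := D.simple_obtuse α hα β hβ hne
      have h2 := hl β (D.Δ_subset hβ)
      nlinarith

end Aux

section Transfer

variable {X Xv X' Xv' : Type} [AddCommGroup X] [AddCommGroup Xv]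
    [AddCommGroup X'] [AddCommGroup Xv'] [Module.Free ℤ X] [Module.Free ℤ X']
    (D : RootDatumBase X Xv) (D' : RootDatumBase X' Xv') (e : X ≃+ X')

theorem transfer_Δ (hQ : ∀ x, x ∈ D.Qplus ↔ e x ∈ D'.Qplus) {α : X} (hα : α ∈ D.Δ) :
    e α ∈ D'.Δ := by
  obtain ⟨h1, h2, h3⟩ := D.mem_Δ_iff.1 hα
  refine D'.mem_Δ_iff.2 ⟨(hQ α).1 h1, by simpa using h2, fun a ha b hb hab => ?_⟩
  have := h3 (e.symm a) ((hQ _).2 (by simpa using ha)) (e.symm b) ((hQ _).2 (by simpa using hb))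
    (by rw [← map_add, ← hab]; simp)
  simpa using this

theorem transfer_pair_simple (hX : ∀ x, x ∈ D.Xplus ↔ e x ∈ D'.Xplus) {α : X} (hα : α ∈ D.Δ)
    (hα' : e α ∈ D'.Δ) (x : X) :
    D'.pair (e x) (D'.coroot (e α)) = D.pair x (D.coroot α) := by
  have hdom : ∀ l ∈ D.Xplus, D'.pair (e l) (D'.coroot (e α)) = D.pair l (D.coroot α) := by
    intro l hl
    have hl' := (hX l).1 hl
    have key : ∀ k : ℤ, 0 ≤ k →
        (k ≤ D.pair l (D.coroot α) ↔ k ≤ D'.pair (e l) (D'.coroot (e α))) := by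
      intro k hk
      rw [← D.two_smul_sub_mem_iff hα hl hk, ← D'.two_smul_sub_mem_iff hα' hl' hk, hX, map_sub,
        map_zsmul, map_zsmul]
    have h1 := hl α (D.Δ_subset hα)
    have h2 := hl' _ (D'.Δ_subset hα')
    exact le_antisymm ((key _ h2).2 le_rfl) ((key _ h1).1 le_rfl)
  obtain ⟨a, ha, hxa⟩ := D.exists_shift x
  have := hdom _ hxa
  simp only [map_add, LinearMap.add_apply, hdom a ha] at this
  exact add_right_cancel this

theorem transfer_root (hX : ∀ x, x ∈ D.Xplus ↔ e x ∈ D'.Xplus)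
    (hQ : ∀ x, x ∈ D.Qplus ↔ e x ∈ D'.Qplus) {β : X} (hβ : β ∈ D.R) :
    e β ∈ D'.R ∧ ∀ x, D'.pair (e x) (D'.coroot (e β)) = D.pair x (D.coroot β) := by
  have hpos : ∀ β ∈ D.Rpos,
      e β ∈ D'.R ∧ ∀ x, D'.pair (e x) (D'.coroot (e β)) = D.pair x (D.coroot β) := by
    refine D.pos_induction (P := fun β => e β ∈ D'.R ∧
      ∀ x, D'.pair (e x) (D'.coroot (e β)) = D.pair x (D.coroot β)) ?_ ?_
    · intro α hα
      have hα' := transfer_Δ D D' e hQ hα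
      exact ⟨D'.mem_R_of_Δ hα', transfer_pair_simple D D' e hX hα hα'⟩
    · intro α hα β hβ _ hr ih
      have hα' := transfer_Δ D D' e hQ hα
      have hp := transfer_pair_simple D D' e hX hα hα'
      have hαR := D.mem_R_of_Δ hα
      set b := β - D.pair β (D.coroot α) • α with hb
      have hββ : β = b - D.pair b (D.coroot α) • α := by
        simp only [hb, map_sub, map_smul, LinearMap.sub_apply, LinearMap.smul_apply,
          D.pair_self α hαR, smul_eq_mul]
        module
      have heβ : e β = e b - D'.pair (e b) (D'.coroot (e α)) • e α := by
        conv_lhs => rw [hββ]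
        rw [map_sub, map_zsmul, hp]
      refine ⟨?_, fun x => ?_⟩
      · rw [heβ]
        exact D'.reflect_mem _ (D'.mem_R_of_Δ hα') _ ih.1
      · rw [heβ, D'.coroot_reflect (D'.mem_R_of_Δ hα') ih.1]
        conv_rhs => rw [hββ, D.coroot_reflect hαR (D.Rpos_subset hr)]
        simp only [map_sub, map_smul, ih.2, hp]
  rcases D.pos_or_neg β hβ with h | h
  · exact hpos β h
  · obtain ⟨h1, h2⟩ := hpos _ h
    rw [map_neg] at h1
    have h1' : e β ∈ D'.R := by simpa using D'.neg_mem h1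
    refine ⟨h1', fun x => ?_⟩
    have := h2 x
    rw [map_neg, D'.coroot_neg h1', D.coroot_neg hβ, map_neg, map_neg] at this
    exact neg_injective this

end Transfer

end RootDatumBase

/-- Lemma B.5. Any isomorphism of the partially ordered monoids of
dominant elements extends uniquely to a group isomorphism `e : X → X'`, which moreover
maps `Δ` onto `Δ'`, maps `R` onto `R'`, and preserves the pairings with coroots. -/
theorem poset_monoid_iso_extends_to_based_root_datum_iso
    {X Xv X' Xv' : Type} [AddCommGroup X] [AddCommGroup Xv]
    [AddCommGroup X'] [AddCommGroup Xv']
    [Module.Free ℤ X] [Module.Finite ℤ X]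
    [Module.Free ℤ X'] [Module.Finite ℤ X']
    (D : RootDatumBase X Xv) (D' : RootDatumBase X' Xv')
    (f : X → X') (hbij : Set.BijOn f D.Xplus D'.Xplus)
    (hadd : ∀ l ∈ D.Xplus, ∀ m ∈ D.Xplus, f (l + m) = f l + f m)
    (horder : ∀ l ∈ D.Xplus, ∀ m ∈ D.Xplus, (D.dle l m ↔ D'.dle (f l) (f m))) :
    ∃ e : X ≃+ X',
      (∀ l ∈ D.Xplus, e l = f l) ∧
      Set.BijOn e ↑D.Δ ↑D'.Δ ∧
      Set.BijOn e ↑D.R ↑D'.R ∧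
      (∀ x : X, ∀ α ∈ D.R, D'.pair (e x) (D'.coroot (e α)) = D.pair x (D.coroot α)) ∧
      (∀ e' : X ≃+ X', (∀ l ∈ D.Xplus, e' l = f l) → e' = e) := by
  classical
  have hmaps := hbij.mapsTo
  obtain ⟨e1, he1⟩ := D.exists_hom f hadd
  set g : X' → X := Function.invFunOn f D.Xplus with hg
  have hgm : ∀ y ∈ D'.Xplus, g y ∈ D.Xplus := fun y hy => Function.invFunOn_mem (hbij.surjOn hy)
  have hfg : ∀ y ∈ D'.Xplus, f (g y) = y := fun y hy => Function.invFunOn_eq (hbij.surjOn hy)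
  have hgf : ∀ x ∈ D.Xplus, g (f x) = x := fun x hx =>
    hbij.injOn (hgm _ (hmaps hx)) hx (hfg _ (hmaps hx))
  have hgadd : ∀ l ∈ D'.Xplus, ∀ m ∈ D'.Xplus, g (l + m) = g l + g m := by
    intro l hl m hm
    apply hbij.injOn (hgm _ (D'.add_mem_Xplus hl hm)) (D.add_mem_Xplus (hgm l hl) (hgm m hm))
    rw [hfg _ (D'.add_mem_Xplus hl hm), hadd _ (hgm l hl) _ (hgm m hm), hfg l hl, hfg m hm]
  obtain ⟨e2, he2⟩ := D'.exists_hom g hgadd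
  have h21 : e2.comp e1 = AddMonoidHom.id X := D.hom_ext fun l hl => by
    simp [he1 l hl, he2 _ (hmaps hl), hgf l hl]
  have h12 : e1.comp e2 = AddMonoidHom.id X' := D'.hom_ext fun l hl => by
    simp [he2 l hl, he1 _ (hgm l hl), hfg l hl]
  let e : X ≃+ X' := AddMonoidHom.toAddEquiv e1 e2 h21 h12
  have he : ∀ l ∈ D.Xplus, e l = f l := he1
  have hes : ∀ l ∈ D'.Xplus, e.symm l = g l := he2
  have hX : ∀ x, x ∈ D.Xplus ↔ e x ∈ D'.Xplus := by
    intro x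
    refine ⟨fun h => he x h ▸ hmaps h, fun h => ?_⟩
    have := hgm _ h
    rw [← hes _ h] at this
    simpa using this
  have hQ : ∀ x, x ∈ D.Qplus ↔ e x ∈ D'.Qplus := by
    intro x
    obtain ⟨a, ha, hxa⟩ := D.exists_shift x
    have := horder a ha _ hxa
    rw [RootDatumBase.dle, RootDatumBase.dle, ← he a ha, ← he _ hxa, map_add, add_sub_cancel_right,
      add_sub_cancel_right] at this
    exact this
  have hX' : ∀ x, x ∈ D'.Xplus ↔ e.symm x ∈ D.Xplus := fun x => by rw [hX]; simp
  have hQ' : ∀ x, x ∈ D'.Qplus ↔ e.symm x ∈ D.Qplus := fun x => by rw [hQ]; simp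
  refine ⟨e, he, ⟨fun α hα => RootDatumBase.transfer_Δ D D' e hQ hα, e.injective.injOn,
    fun α hα => ⟨e.symm α, RootDatumBase.transfer_Δ D' D e.symm hQ' hα, by simp⟩⟩,
    ⟨fun α hα => (RootDatumBase.transfer_root D D' e hX hQ hα).1, e.injective.injOn,
    fun α hα => ⟨e.symm α, (RootDatumBase.transfer_root D' D e.symm hX' hQ' hα).1, by simp⟩⟩,
    fun x α hα => (RootDatumBase.transfer_root D D' e hX hQ hα).2 x, ?_⟩
  intro e' he'
  have : e'.toAddMonoidHom = e.toAddMonoidHom := D.hom_ext fun l hl => by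
    change e' l = e l
    rw [he' l hl, he l hl]
  ext x
  exact DFunLike.congr_fun this x
end
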